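/- arXiv:2302.03119 — 3 statements merged into one kernel-verified Lean document; each statement's English description precedes it below -/
import Mathlib

section
/- Let H be the rank-16 distribution on R^24 defined as the common kernel of the eight explicit 1-forms λ^1,…,λ^8 (the E_II Pfaffian system). Then the set of smooth vector fields Y on R^24 such that [Y,X] is a section of H for every smooth section X of H is a Lie subalgebra of the Lie algebra of smooth vector fields on R^24 which, as an abstract real Lie algebra, is simple and has dimension 78 (it is the real form E_II of the exceptional Lie algebra e_6). -/
noncomputable section
open ComplexConjugate

/-- Points of `ℝ²⁴`, with coordinates `u^i = p (i-1)`, `x^i = p (7+i)`, `y^i = p (15+i)`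
for `i = 1, …, 8`. -/
abbrev Pt : Type := Fin 24 → ℝ
/-- The eight 1-forms `λ^1, …, λ^8` of the E_II Pfaffian system on `ℝ²⁴`,
evaluated at the base point `p` on the tangent vector `v`. -/
def lam (p v : Pt) : Fin 8 → ℝ :=
  ![v 0 + (1/2) * (p 8 * v 19 + p 9 * v 18 + p 10 * v 17 + p 11 * v 16
      - p 16 * v 11 - p 17 * v 10 - p 18 * v 9 - p 19 * v 8),
    v 1 + (1/2) * (p 8 * v 21 + p 9 * v 20 + p 12 * v 17 + p 13 * v 16
      - p 16 * v 13 - p 17 * v 12 - p 20 * v 9 - p 21 * v 8),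
    v 2 + (1/2) * (p 8 * v 14 - p 10 * v 12 + p 12 * v 10 - p 14 * v 8
      + p 16 * v 22 - p 18 * v 20 + p 20 * v 18 - p 22 * v 16),
    v 3 + (1/2) * (p 8 * v 15 + p 9 * v 14 + p 10 * v 13 + p 11 * v 12
      - p 12 * v 11 - p 13 * v 10 - p 14 * v 9 - p 15 * v 8
      + p 16 * v 23 + p 17 * v 22 + p 18 * v 21 + p 19 * v 20
      - p 20 * v 19 - p 21 * v 18 - p 22 * v 17 - p 23 * v 16),
    v 4 + (1/2) * (p 16 * v 15 - p 17 * v 14 - p 18 * v 13 + p 19 * v 12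
      + p 20 * v 11 - p 21 * v 10 - p 22 * v 9 + p 23 * v 8
      - p 8 * v 23 + p 9 * v 22 + p 10 * v 21 - p 11 * v 20
      - p 12 * v 19 + p 13 * v 18 + p 14 * v 17 - p 15 * v 16),
    v 5 + (1/2) * (p 9 * v 15 - p 11 * v 13 + p 13 * v 11 - p 15 * v 9
      + p 17 * v 23 - p 19 * v 21 + p 21 * v 19 - p 23 * v 17),
    v 6 + (1/2) * (p 10 * v 23 + p 11 * v 22 + p 14 * v 19 + p 15 * v 18
      - p 18 * v 15 - p 19 * v 14 - p 22 * v 11 - p 23 * v 10),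
    v 7 + (1/2) * (p 12 * v 23 + p 13 * v 22 + p 14 * v 21 + p 15 * v 20
      - p 20 * v 15 - p 21 * v 14 - p 22 * v 13 - p 23 * v 12)]
/-- The Lie bracket of vector fields on `ℝ²⁴`, identified with maps `ℝ²⁴ → ℝ²⁴`
via the standard trivialization of the tangent bundle. -/
def vfBracket (X Y : Pt → Pt) : Pt → Pt :=
  fun p => fderiv ℝ Y p (X p) - fderiv ℝ X p (Y p)

/-- `X` is a smooth section of the rank-16 distribution `H` annihilated by the
eight 1-forms `λ^i`. -/
def IsSectionH (X : Pt → Pt) : Prop :=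
  ContDiff ℝ (⊤ : ℕ∞) X ∧ ∀ p : Pt, ∀ i : Fin 8, lam p (X p) i = 0

/-- The set of infinitesimal symmetries of the distribution `H`: smooth vector fields
`Y` such that `[Y, X]` is again a section of `H` for every smooth section `X` of `H`. -/
def symH : Set (Pt → Pt) :=
  {Y | ContDiff ℝ (⊤ : ℕ∞) Y ∧
    ∀ X : Pt → Pt, IsSectionH X → ∀ p : Pt, ∀ i : Fin 8, lam p (vfBracket Y X p) i = 0}

/-- Row `b`, column `i`: the index paired with `b` by the `i`-th skew form, with the sign. -/
def skewTable : List (List (ℕ × ℤ)) := [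
  [(11, 1), (13, 1), (6, 1), (7, 1), (15, -1), (0, 0), (0, 0), (0, 0)],
  [(10, 1), (12, 1), (0, 0), (6, 1), (14, 1), (7, 1), (0, 0), (0, 0)],
  [(9, 1), (0, 0), (4, -1), (5, 1), (13, 1), (0, 0), (15, 1), (0, 0)],
  [(8, 1), (0, 0), (0, 0), (4, 1), (12, -1), (5, -1), (14, 1), (0, 0)],
  [(0, 0), (9, 1), (2, 1), (3, -1), (11, -1), (0, 0), (0, 0), (15, 1)],
  [(0, 0), (8, 1), (0, 0), (2, -1), (10, 1), (3, 1), (0, 0), (14, 1)],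
  [(0, 0), (0, 0), (0, -1), (1, -1), (9, 1), (0, 0), (11, 1), (13, 1)],
  [(0, 0), (0, 0), (0, 0), (0, -1), (8, -1), (1, -1), (10, 1), (12, 1)],
  [(3, -1), (5, -1), (14, 1), (15, 1), (7, 1), (0, 0), (0, 0), (0, 0)],
  [(2, -1), (4, -1), (0, 0), (14, 1), (6, -1), (15, 1), (0, 0), (0, 0)],
  [(1, -1), (0, 0), (12, -1), (13, 1), (5, -1), (0, 0), (7, -1), (0, 0)],
  [(0, -1), (0, 0), (0, 0), (12, 1), (4, 1), (13, -1), (6, -1), (0, 0)],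
  [(0, 0), (1, -1), (10, 1), (11, -1), (3, 1), (0, 0), (0, 0), (7, -1)],
  [(0, 0), (0, -1), (0, 0), (10, -1), (2, -1), (11, 1), (0, 0), (6, -1)],
  [(0, 0), (0, 0), (8, -1), (9, -1), (1, -1), (0, 0), (3, -1), (5, -1)],
  [(0, 0), (0, 0), (0, 0), (8, -1), (0, 1), (9, -1), (2, -1), (4, -1)]]

def partner (b : Fin 16) (i : Fin 8) : Fin 16 :=
  Fin.ofNat 16 ((skewTable.getD b []).getD i (0, 0)).1

def sgn (b : Fin 16) (i : Fin 8) : ℤ := ((skewTable.getD b []).getD i (0, 0)).2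

/-- The matrix entry `(a, b)` of the `i`-th skew form. -/
def skew (i : Fin 8) (a b : Fin 16) : ℤ := if partner a i = b then sgn a i else 0

/-- The index dual to `i` under the invariant quadratic form on the centre. -/
def dual (i : Fin 8) : Fin 8 := if i = 3 ∨ i = 4 then i else i.rev

/-- Twice the nonzero entry in row `i` of the invariant quadratic form on the centre. -/
def eta (i : Fin 8) : ℤ := [2, -2, 2, -1, -1, 2, -2, 2].getD i 0

def etaForm (i j : Fin 8) : ℤ := if dual j = i then eta j else 0

theorem sgn_cases (b : Fin 16) (i : Fin 8) : sgn b i = 0 ∨ sgn b i = 1 ∨ sgn b i = -1 := by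
  revert b i; decide +kernel

theorem skew_antisymm (i : Fin 8) (a b : Fin 16) : skew i b a = -skew i a b := by
  revert a b i; decide +kernel

def weight (i : Fin 8) : ℤ := if i = 3 ∨ i = 4 then 1 else 2

theorem skew_gram (i k : Fin 8) : ∑ a, ∑ b, skew i a b * skew k a b =
    if i = k then (if i = 3 ∨ i = 4 then 16 else 8) else 0 := by
  revert i k; decide +kernel

/-- A module over the Heisenberg-type algebra spanned by `X b`, `U i`, together with a solution
`(f, g)` of the symmetry equations. -/
structure SymmetryData (C : Type*) [AddCommGroup C] [Module ℝ C] where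
  X : Fin 16 → C →ₗ[ℝ] C
  U : Fin 8 → C →ₗ[ℝ] C
  comm_XX : ∀ a b h, X a (X b h) - X b (X a h) = -∑ i, (skew i a b : ℝ) • U i h
  comm_UX : ∀ i b h, U i (X b h) = X b (U i h)
  f : Fin 8 → C
  g : Fin 16 → C
  X_f : ∀ b i, X b (f i) = (sgn b i : ℝ) • g (partner b i)

namespace SymmetryData
variable {C : Type*} [AddCommGroup C] [Module ℝ C] (S : SymmetryData C)

theorem X_f_eq_zero {b i} (h : sgn b i = 0) : S.X b (S.f i) = 0 := by
  rw [S.X_f, h]; simp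

theorem g_eq {d i c} (h : sgn d i ≠ 0) (hc : partner d i = c) :
    S.g c = (sgn d i : ℝ) • S.X d (S.f i) := by
  rw [S.X_f, smul_smul, hc]
  rcases sgn_cases d i with h' | h' | h' <;> simp_all

theorem comm_UU (i j h) : S.U i (S.U j h) = S.U j (S.U i h) := by
  have key : ∃ a b, ∀ k, skew k a b = if k = j then 1 else 0 := by
    revert j; decide +kernel
  obtain ⟨a, b, hab⟩ := key
  have H : ∀ h, S.U j h = -(S.X a (S.X b h) - S.X b (S.X a h)) := by
    intro h; simp [S.comm_XX, hab]
  rw [H, H, map_neg, map_sub, S.comm_UX, S.comm_UX, S.comm_UX, S.comm_UX]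

theorem XX_comm_of {h : C} (hU : ∀ i, S.U i h = 0) (a b) :
    S.X a (S.X b h) = S.X b (S.X a h) := by
  have := S.comm_XX a b h
  simp only [hU, smul_zero, Finset.sum_const_zero, neg_zero] at this
  exact sub_eq_zero.1 this

/-- `f` with its index lowered. -/
def fl (j : Fin 8) : C := (eta j : ℝ) • S.f (dual j)

def φ : C := S.U 3 (S.f 3)

theorem X_fl (b k) : S.X b (S.fl k) =
    ((eta k * sgn b (dual k) : ℤ) : ℝ) • S.g (partner b (dual k)) := by
  rw [fl, map_smul, S.X_f, smul_smul]; push_cast; rfl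

theorem X_fl_eq_zero {b k} (h : sgn b (dual k) = 0) : S.X b (S.fl k) = 0 := by
  rw [X_fl, h]; simp

theorem sum_skew (i h) : (8 : ℝ) • S.U i h =
    -((weight i : ℝ) • ∑ a, (sgn a i : ℝ) • S.X a (S.X (partner a i) h)) := by
  have h1 : ∑ a, (sgn a i : ℝ) • S.X a (S.X (partner a i) h) =
      ∑ a, ∑ b, (skew i a b : ℝ) • S.X a (S.X b h) := by
    refine Finset.sum_congr rfl fun a _ => ?_
    rw [Finset.sum_eq_single (partner a i)]
    · simp [skew]
    · intro b _ hb; simp [skew, hb.symm]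
    · simp
  have h2 : (2 : ℝ) • ∑ a, ∑ b, (skew i a b : ℝ) • S.X a (S.X b h) =
      ∑ a, ∑ b, (skew i a b : ℝ) • (S.X a (S.X b h) - S.X b (S.X a h)) := by
    have : ∑ a, ∑ b, (skew i a b : ℝ) • S.X b (S.X a h) =
        -∑ a, ∑ b, (skew i a b : ℝ) • S.X a (S.X b h) := by
      rw [Finset.sum_comm, ← Finset.sum_neg_distrib]
      refine Finset.sum_congr rfl fun a _ => ?_
      rw [← Finset.sum_neg_distrib]
      refine Finset.sum_congr rfl fun b _ => ?_
      rw [skew_antisymm i a b]; push_cast; rw [neg_smul]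
    simp only [smul_sub, Finset.sum_sub_distrib, this, two_smul, sub_neg_eq_add]
  have h3 : ∑ a, ∑ b, (skew i a b : ℝ) • (S.X a (S.X b h) - S.X b (S.X a h)) =
      -∑ k, ((∑ a, ∑ b, skew i a b * skew k a b : ℤ) : ℝ) • S.U k h := by
    simp only [S.comm_XX, smul_neg, Finset.sum_neg_distrib, Finset.smul_sum, smul_smul]
    push_cast
    simp only [Finset.sum_smul]
    rw [Finset.sum_comm (s := (Finset.univ : Finset (Fin 8)))]
    refine congrArg _ (Finset.sum_congr rfl fun a _ => Finset.sum_comm)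
  rw [h3] at h2
  simp only [skew_gram, Int.cast_ite, ite_smul, Int.cast_zero, zero_smul, Finset.sum_ite_eq,
    Finset.mem_univ, if_true] at h2
  rw [h1]
  unfold weight
  split_ifs at h2 ⊢ with hi
  · push_cast at h2 ⊢
    linear_combination (norm := module) (1 / 2 : ℝ) • h2
  · push_cast at h2 ⊢
    linear_combination (norm := module) (1 : ℝ) • h2

theorem killing_aux (i j h) (hh : h = S.fl j) : (8 : ℝ) • S.U i h =
    -∑ a, ∑ t, ((if partner (partner a i) (dual j) = t then
      weight i * sgn a i * (eta j * sgn (partner a i) (dual j)) else 0 : ℤ) : ℝ) •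
        S.X a (S.g t) := by
  rw [sum_skew, hh, Finset.smul_sum]
  refine congrArg _ (Finset.sum_congr rfl fun a _ => ?_)
  rw [Finset.sum_eq_single (partner (partner a i) (dual j))]
  · rw [X_fl, map_smul, smul_smul, smul_smul, if_pos rfl]; push_cast; rfl
  · intro b _ hb; simp [hb.symm]
  · simp

theorem clifford (a : Fin 16) (i j : Fin 8) (t : Fin 16) :
    (if partner (partner a i) (dual j) = t then
      weight i * sgn a i * (eta j * sgn (partner a i) (dual j)) else 0) +
    (if partner (partner a j) (dual i) = t then
      weight j * sgn a j * (eta i * sgn (partner a j) (dual i)) else 0) =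
    if a = t then -2 * etaForm i j else 0 := by
  revert a i j t; decide +kernel

theorem killing' (i j) : (8 : ℝ) • (S.U i (S.fl j) + S.U j (S.fl i)) =
    ((2 * etaForm i j : ℤ) : ℝ) • ∑ a, S.X a (S.g a) := by
  rw [smul_add, S.killing_aux i j _ rfl, S.killing_aux j i _ rfl, ← neg_add,
    ← Finset.sum_add_distrib, Finset.smul_sum, ← Finset.sum_neg_distrib]
  refine Finset.sum_congr rfl fun a _ => ?_
  rw [← Finset.sum_add_distrib]
  simp_rw [← add_smul, ← Int.cast_add, clifford]
  rw [Finset.sum_eq_single a]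
  · rw [if_pos rfl, ← neg_smul]; push_cast; ring_nf
  · intro b _ hb; simp [hb.symm]
  · simp

theorem killing (i j) : S.U i (S.fl j) + S.U j (S.fl i) =
    ((2 * etaForm i j : ℤ) : ℝ) • S.φ := by
  have h1 := S.killing' 3 3
  have h2 := S.killing' i j
  have e1 : etaForm 3 3 = -1 := by decide +kernel
  have e2 : S.fl 3 = (-1 : ℝ) • S.f 3 := by
    rw [fl, show eta 3 = -1 by decide +kernel, show dual 3 = 3 by decide +kernel]; simp
  rw [e1, e2, map_smul] at h1
  change (8 : ℝ) • ((-1 : ℝ) • S.φ + (-1 : ℝ) • S.φ) = _ at h1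
  have h3 : ∑ a, S.X a (S.g a) = (8 : ℝ) • S.φ := by
    push_cast at h1
    linear_combination (norm := module) (1 / 2 : ℝ) • h1
  rw [h3] at h2
  have := congrArg (fun x => (1 / 8 : ℝ) • x) h2
  simp only [smul_smul] at this
  norm_num at this
  rw [this]
  push_cast
  congr 1
  ring

/-- The conformal identity for second derivatives. -/
theorem conformal (i j k) : S.U i (S.U j (S.fl k)) =
    (etaForm i k : ℝ) • S.U j S.φ + (etaForm j k : ℝ) • S.U i S.φ
      - (etaForm i j : ℝ) • S.U k S.φ := by
  have sym : ∀ i j, etaForm i j = etaForm j i := by decide +kernel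
  have h1 := congrArg (S.U i) (S.killing j k)
  have h2 := congrArg (S.U j) (S.killing i k)
  have h3 := congrArg (S.U k) (S.killing i j)
  simp only [map_add, map_smul] at h1 h2 h3
  rw [S.comm_UU k i, S.comm_UU k j] at h3
  rw [S.comm_UU j i] at h2
  push_cast at h1 h2 h3
  linear_combination (norm := module) (1 / 2 : ℝ) • h1 + (1 / 2 : ℝ) • h2 - (1 / 2 : ℝ) • h3

theorem X_U_φ (b j) : S.X b (S.U j S.φ) = 0 := by
  have key : ∃ k i, sgn b (dual k) = 0 ∧ (etaForm i k = 2 ∨ etaForm i k = -2) ∧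
      ((etaForm j k = 0 ∧ etaForm i j = 0) ∨ (i = j ∧ etaForm i j = 0)) := by
    revert b j; decide +kernel
  obtain ⟨k, i, h1, h2, h3⟩ := key
  have H := congrArg (S.X b) (S.conformal i j k)
  rw [← S.comm_UX, ← S.comm_UX, S.X_fl_eq_zero h1, map_zero, map_zero, map_sub, map_add,
    map_smul, map_smul, map_smul] at H
  rcases h3 with ⟨h3, h4⟩ | ⟨rfl, h4⟩
  · rw [h3, h4] at H
    rcases h2 with h2 | h2 <;> rw [h2] at H <;> simpa using H.symm
  · rw [h4, ← add_smul] at H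
    simp only [Int.cast_zero, zero_smul, sub_zero] at H
    refine (smul_eq_zero.1 H.symm).resolve_left ?_
    rcases h2 with h2 | h2 <;> rw [h2] <;> norm_num

theorem fl_dual (k) : S.fl (dual k) = (eta (dual k) : ℝ) • S.f k := by
  have : dual (dual k) = k := by revert k; decide +kernel
  rw [fl, this]

theorem eta_ne_zero (k) : (eta k : ℝ) ≠ 0 := by
  have : ∀ k, eta k ≠ 0 := by decide +kernel
  exact_mod_cast this k

theorem U_f_eq_zero {i k} (h : S.U i (S.fl (dual k)) = 0) : S.U i (S.f k) = 0 := by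
  rw [fl_dual, map_smul] at h
  exact (smul_eq_zero.1 h).resolve_left (eta_ne_zero _)

theorem U_U_f (hτ : ∀ j, S.U j S.φ = 0) (i j k) : S.U i (S.U j (S.f k)) = 0 := by
  have h := S.conformal i j (dual k)
  simp only [hτ, smul_zero, fl_dual, map_smul, add_zero, sub_zero] at h
  exact (smul_eq_zero.1 h).resolve_left (eta_ne_zero _)

theorem X_U_g (hτ : ∀ j, S.U j S.φ = 0) {a d i} (k) (hd : sgn d i ≠ 0) (ha : sgn a i = 0) :
    S.X a (S.U k (S.g (partner d i))) = 0 := by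
  rw [S.g_eq hd rfl, map_smul, map_smul, S.comm_UX,
    S.XX_comm_of fun j => S.U_U_f hτ j k i, ← S.comm_UX k a, S.X_f_eq_zero ha]
  simp

theorem X_X_φ (hτ : ∀ j, S.U j S.φ = 0) (a b) : S.X a (S.X b S.φ) = 0 := by
  have key : ∃ k l, sgn b (dual k) = 0 ∧ (etaForm k l = 2 ∨ etaForm k l = -2) ∧
      ∃ d i, sgn d i ≠ 0 ∧ partner d i = partner b (dual l) ∧ sgn a i = 0 := by
    revert a b; decide +kernel
  obtain ⟨k, l, h1, h2, d, i, h4, h5, h6⟩ := key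
  have H := congrArg (fun h => S.X a (S.X b h)) (S.killing k l)
  simp only [map_add, map_smul] at H
  rw [← S.comm_UX l b, S.X_fl_eq_zero h1, ← S.comm_UX k b, X_fl, map_smul, map_smul, ← h5,
    S.X_U_g hτ k h4 h6] at H
  rcases h2 with h2 | h2 <;> rw [h2] at H <;> simpa using H.symm

section Constant
variable (hφ : S.φ = 0)
include hφ

theorem X_U_fl (b i j) : S.X b (S.U i (S.fl j)) = 0 := by
  have skw : ∀ i j, S.U i (S.fl j) = -S.U j (S.fl i) := by
    intro i j
    have := S.killing i j
    rw [hφ, smul_zero] at this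
    exact eq_neg_of_add_eq_zero_left this
  have base : ∀ {b i j}, sgn b (dual i) = 0 → S.X b (S.U i (S.fl j)) = 0 := by
    intro b i j h
    rw [skw, map_neg, ← S.comm_UX, S.X_fl_eq_zero h]; simp
  have step : ∀ {b i j}, (∃ d k, sgn d k ≠ 0 ∧ partner d k = partner b (dual j) ∧
      S.X d (S.U i (S.fl (dual k))) = 0) → S.X b (S.U i (S.fl j)) = 0 := by
    rintro b i j ⟨d, k, h1, h2, h3⟩
    rw [fl_dual, map_smul, map_smul] at h3
    have h3 := (smul_eq_zero.1 h3).resolve_left (eta_ne_zero _)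
    rw [← S.comm_UX, X_fl, map_smul, ← h2, S.g_eq h1 rfl, map_smul, S.comm_UX, h3]
    simp
  have null : ∀ b i j, dual i ≠ i → S.X b (S.U i (S.fl j)) = 0 := by
    intro b i j hi
    by_cases hj : sgn b (dual j) = 0
    · rw [← S.comm_UX, S.X_fl_eq_zero hj, map_zero]
    have key : ∃ d k, sgn d k ≠ 0 ∧ partner d k = partner b (dual j) ∧ sgn d (dual i) = 0 := by
      revert b i j; decide +kernel
    obtain ⟨d, k, h1, h2, h3⟩ := key
    exact step ⟨d, k, h1, h2, base h3⟩
  by_cases hj : sgn b (dual j) = 0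
  · rw [← S.comm_UX, S.X_fl_eq_zero hj, map_zero]
  have key : ∃ d k, sgn d k ≠ 0 ∧ partner d k = partner b (dual j) ∧
      dual (dual k) ≠ dual k := by
    revert b j; decide +kernel
  obtain ⟨d, k, h1, h2, h3⟩ := key
  refine step ⟨d, k, h1, h2, ?_⟩
  rw [skw, map_neg, null _ _ _ h3, neg_zero]

end Constant

section Killed
variable (hL : ∀ i k, S.U i (S.f k) = 0)
include hL

theorem U_g (i c) : S.U i (S.g c) = 0 := by
  have key : ∃ d k, sgn d k ≠ 0 ∧ partner d k = c := by revert c; decide +kernel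
  obtain ⟨d, k, h1, h2⟩ := key
  rw [S.g_eq h1 h2, map_smul, S.comm_UX, hL]; simp

theorem X_g_of_ann {a d i} (hd : sgn d i ≠ 0) (ha : sgn a i = 0) :
    S.X a (S.g (partner d i)) = 0 := by
  rw [S.g_eq hd rfl, map_smul, S.XX_comm_of fun j => hL j i, S.X_f_eq_zero ha]; simp

theorem X_g_swap {a d i} (hd : sgn d i ≠ 0) :
    S.X a (S.g (partner d i)) = ((sgn d i * sgn a i : ℤ) : ℝ) • S.X d (S.g (partner a i)) := by
  rw [S.g_eq hd rfl, map_smul, S.XX_comm_of fun j => hL j i, S.X_f, map_smul, smul_smul]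
  push_cast; rfl

theorem X_X_g (b) : S.X b (S.X 0 (S.g 8)) = 0 := by
  have key : ∃ d i, sgn d i ≠ 0 ∧ partner d i = 8 ∧ ∃ d' i', sgn d' i' ≠ 0 ∧
      partner d' i' = partner 0 i ∧ sgn b i' = 0 := by revert b; decide +kernel
  obtain ⟨d, i, h1, h2, d', i', h3, h4, h5⟩ := key
  rw [← h2, S.X_g_swap hL h1, map_smul, S.XX_comm_of fun j => S.U_g hL j _, ← h4,
    S.X_g_of_ann hL h3 h5]
  simp

theorem X_g_self (a) : S.X a (S.g a) = 0 := by
  have key : ∃ i j k, sgn a i ≠ 0 ∧ sgn (partner a i) j ≠ 0 ∧ sgn a k ≠ 0 ∧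
      partner (partner a i) j = partner a k := by
    revert a; decide +kernel
  have swap : ∀ a i, sgn a i ≠ 0 → S.X a (S.g a) = -S.X (partner a i) (S.g (partner a i)) := by
    intro a i h
    have h1 : sgn a i ≠ 0 → sgn (partner a i) i * sgn a i = -1 ∧ sgn (partner a i) i ≠ 0 ∧
        partner (partner a i) i = a := by
      revert a i; decide +kernel
    obtain ⟨h1, h2, h3⟩ := h1 h
    have := S.X_g_swap hL (a := a) h2
    rw [h3, h1] at this
    simpa using this
  obtain ⟨i, j, k, h1, h2, h3, h4⟩ := key
  have e := swap a i h1
  rw [swap _ j h2, h4, neg_neg, ← neg_eq_iff_eq_neg.2 (swap a k h3)] at e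
  have : (2 : ℝ) • S.X a (S.g a) = 0 := by
    rw [two_smul]; nth_rw 1 [e]; simp
  simpa using this

theorem X_g (hθ : S.X 0 (S.g 8) = 0) (a c) : S.X a (S.g c) = 0 := by
  have step : ∀ {a c}, (∃ d i, sgn d i ≠ 0 ∧ partner d i = c ∧
      S.X d (S.g (partner a i)) = 0) → S.X a (S.g c) = 0 := by
    rintro a c ⟨d, i, h1, h2, h3⟩
    rw [← h2, S.X_g_swap hL h1, h3, smul_zero]
  have key : a = c ∨ (∃ d i, sgn d i ≠ 0 ∧ partner d i = c ∧ sgn a i = 0) ∨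
      (a = 0 ∧ c = 8) ∨
      (∃ i, sgn 0 i ≠ 0 ∧ partner 0 i = c ∧ partner a i = 8) ∨
      (∃ d i, sgn d i ≠ 0 ∧ partner d i = c ∧ ∃ j, sgn 0 j ≠ 0 ∧ partner 0 j = partner a i ∧
        partner d j = 8) := by
    revert a c; decide +kernel
  rcases key with rfl | ⟨d, i, h1, rfl, h2⟩ | ⟨rfl, rfl⟩ | ⟨i, h1, h2, h3⟩ |
    ⟨d, i, h1, h2, j, h3, h4, h5⟩
  · exact S.X_g_self hL _
  · exact S.X_g_of_ann hL h1 h2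
  · exact hθ
  · exact step ⟨0, i, h1, h2, h3 ▸ hθ⟩
  · exact step ⟨d, i, h1, h2, step ⟨0, j, h3, h4, h5 ▸ hθ⟩⟩

end Killed

/-- A solution all of whose Taylor functionals vanish is zero, for any evaluation functional
that detects constants. -/
theorem f_eq_zero (ev : C →ₗ[ℝ] ℝ) (hev : ∀ h, (∀ b, S.X b h = 0) → ev h = 0 → h = 0)
    (h0 : ∀ i, ev (S.f i) = 0) (h1 : ∀ a, ev (S.g a) = 0)
    (h2 : ∀ i j, i < j → ev (S.U i (S.f (dual j))) = 0) (h3 : ev S.φ = 0)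
    (h4 : ev (S.X 0 (S.g 8)) = 0) (h5 : ∀ a, ev (S.X a S.φ) = 0)
    (h6 : ∀ j, ev (S.U j S.φ) = 0) (i) : S.f i = 0 := by
  have hτ : ∀ j, S.U j S.φ = 0 := fun j => hev _ (fun b => S.X_U_φ b j) (h6 j)
  have hρ : ∀ a, S.X a S.φ = 0 := fun a => hev _ (fun b => S.X_X_φ hτ b a) (h5 a)
  have hφ : S.φ = 0 := hev _ hρ h3
  have hlt : ∀ i j, i < j → S.U i (S.fl j) = 0 := fun i j h =>
    hev _ (fun b => S.X_U_fl hφ b i j) (by rw [fl, map_smul, map_smul, h2 i j h, smul_zero])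
  have hfl : ∀ i j, S.U i (S.fl j) = 0 := by
    intro i j
    have hk := S.killing i j
    rw [hφ, smul_zero] at hk
    rcases lt_trichotomy i j with h | rfl | h
    · exact hlt _ _ h
    · rw [← two_smul ℝ] at hk
      simpa using hk
    · rwa [hlt _ _ h, add_zero] at hk
  have hL : ∀ i k, S.U i (S.f k) = 0 := fun i k => S.U_f_eq_zero (hfl i (dual k))
  have hg : ∀ a, S.g a = 0 := fun a =>
    hev _ (fun b => S.X_g hL (hev _ (S.X_X_g hL) h4) b a) (h1 a)
  exact hev _ (fun b => by rw [S.X_f, hg, smul_zero]) (h0 i)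

end SymmetryData
/-- The matrices of the frame derivatives on the jets of symmetries: entry `(k, r)` lists the
nonzero coefficients of row `r` of the matrix of the `k`-th frame field. -/
def frameTable : List (List (List (ℕ × ℤ))) := [
  [[(30, 2)], [(29, 2)], [(28, 2)], [(26, 2)], [(27, 2)], [(25, 2)], [(24, 2)], [], [(65, -4)],
    [(64, -4)], [(63, -4)], [(62, -4)], [], [], [], [], [(57, 4)], [(56, 4)], [(55, 4)],
    [(54, 4)], [], [], [], [], [], [], [], [], [], [], [(70, 4)], [], [], [], [], [(70, 2)],
    [(71, 2)], [], [], [(70, 2)], [], [(72, 2)], [], [], [], [(73, 2)], [], [], [(74, 2)], [],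
    [(75, 2)], [(76, 2)], [(70, 2)]],
  [[(36, 2)], [(35, 2)], [(34, 2)], [(32, 2)], [(33, 2)], [(31, 2)], [], [(24, 2)], [(67, -4)],
    [(66, -4)], [], [], [(63, -4)], [(62, -4)], [], [], [(59, 4)], [(58, 4)], [], [], [(55, 4)],
    [(54, 4)], [], [], [], [], [], [], [], [(70, 2)], [(71, 2)], [], [], [], [], [(71, 4)], [],
    [], [], [(71, 2)], [(72, 2)], [], [], [], [(73, 2)], [], [], [(74, 2)], [], [(75, 2)], [],
    [(77, 2)], [(71, 2)]],
  [[(41, 2)], [(40, 2)], [(39, 2)], [(37, 2)], [(38, 2)], [], [(31, 2)], [(25, -2)], [(60, -4)],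
    [], [(58, 4)], [], [(56, -4)], [], [(54, 4)], [], [(68, -4)], [], [(66, 4)], [], [(64, -4)],
    [], [(62, 4)], [], [], [], [], [], [(70, 2)], [], [(72, 2)], [], [], [], [(71, 2)],
    [(72, 2)], [], [], [], [(72, 4)], [], [], [], [(73, 2)], [], [], [(74, 2)], [], [],
    [(76, 2)], [(77, -2)], [], [(72, 2)]],
  [[(45, 2)], [(44, 2)], [(43, 2)], [(52, 2)], [(42, 2)], [(37, 1)], [(32, -1)], [(26, 1)],
    [(61, -2)], [(60, -2)], [(59, -2)], [(58, -2)], [(57, 2)], [(56, 2)], [(55, 2)], [(54, 2)],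
    [(69, -2)], [(68, -2)], [(67, -2)], [(66, -2)], [(65, 2)], [(64, 2)], [(63, 2)], [(62, 2)],
    [], [], [(70, 2)], [], [], [], [(73, 2)], [], [(71, 2)], [], [], [(73, 2)], [], [(72, 2)],
    [], [(73, 2)], [], [], [(74, -2)], [(75, 1)], [(76, -1)], [(77, 1)], [], [], [], [], [], [],
    [(73, 2)], [(74, -2)]],
  [[(48, 2)], [(47, 2)], [(46, 2)], [(42, -2)], [(52, 2)], [(38, 1)], [(33, -1)], [(27, 1)],
    [(69, 2)], [(68, -2)], [(67, -2)], [(66, 2)], [(65, 2)], [(64, -2)], [(63, -2)], [(62, 2)],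
    [(61, -2)], [(60, 2)], [(59, 2)], [(58, -2)], [(57, -2)], [(56, 2)], [(55, 2)], [(54, -2)],
    [], [], [], [(70, 2)], [], [], [(74, 2)], [], [], [(71, 2)], [], [(74, 2)], [], [],
    [(72, 2)], [(74, 2)], [], [], [(73, 2)], [], [], [], [(75, 1)], [(76, -1)], [(77, 1)], [],
    [], [], [(74, 2)], [(73, 2)]],
  [[(50, 2)], [(49, 2)], [], [(43, 4)], [(46, 4)], [(39, -2), (52, 4)], [(34, 2)], [(28, -2)],
    [], [(61, -4)], [], [(59, 4)], [], [(57, -4)], [], [(55, 4)], [], [(69, -4)], [], [(67, 4)],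
    [], [(65, -4)], [], [(63, 4)], [], [(70, 2)], [], [], [], [], [(75, 2)], [(71, 2)], [], [],
    [], [(75, 2)], [], [(73, 4)], [(74, 4)], [], [(76, 2)], [(77, -2)], [], [], [], [], [], [],
    [], [], [], [], [(75, 2)]],
  [[(51, 2)], [], [(49, 2)], [(44, -4)], [(47, -4)], [(40, 2)], [(35, -2), (52, 4)], [(29, 2)],
    [], [], [(69, -4)], [(68, -4)], [], [], [(65, -4)], [(64, -4)], [], [], [(61, 4)], [(60, 4)],
    [], [], [(57, 4)], [(56, 4)], [(70, 2)], [], [], [], [], [], [(76, 2)], [(72, 2)],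
    [(73, -4)], [(74, -4)], [(75, 2)], [], [(77, 2)], [], [], [(76, 2)], [], [], [], [], [], [],
    [], [], [], [], [], [], [(76, 2)]],
  [[], [(51, 2)], [(50, -2)], [(45, 4)], [(48, 4)], [(41, -2)], [(36, 2)], [(30, -2), (52, 4)],
    [], [], [], [], [(69, -4)], [(68, -4)], [(67, -4)], [(66, -4)], [], [], [], [], [(61, 4)],
    [(60, 4)], [(59, 4)], [(58, 4)], [(71, 2)], [(72, -2)], [(73, 4)], [(74, 4)], [(75, -2)],
    [(76, 2)], [], [], [], [], [], [(77, 2)], [], [], [], [(77, 2)], [], [], [], [], [], [], [],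
    [], [], [], [], [], [(77, 2)]],
  [[(19, 1)], [(21, 1)], [(14, 1)], [(15, 1)], [(23, -1)], [], [], [],
    [(30, 1), (35, 1), (39, 1), (52, -2)], [(37, 1)], [(33, 1)], [], [(27, -1)], [], [(24, 2)],
    [], [(53, 1)], [(38, -1)], [(32, 1)], [(31, -2)], [(26, -1)], [(25, 2)], [], [], [], [], [],
    [], [], [], [(54, 2)], [], [], [], [], [(54, 2)], [], [], [], [(54, 2)], [], [], [(62, -1)],
    [(55, 1)], [(64, 1)], [(66, -1)], [(63, -1)], [(56, 1)], [(58, -1)], [(65, -2)], [(67, 2)],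
    [(60, 2)], [(54, 1)], [(62, -4)], [], [], [], [], [], [], [(72, -1)], [(73, -1)], [], [], [],
    [(70, -1)], [], [(71, -1)], [], [(74, 1)]],
  [[(18, 1)], [(20, 1)], [], [(14, 1)], [(22, 1)], [(15, 1)], [], [], [(43, 2)],
    [(30, 1), (35, 1), (39, -1)], [], [(33, -1)], [], [(27, 1)], [], [(24, 2)], [(46, 2)],
    [(42, -2), (53, 1)], [(34, -2)], [(32, 1)], [(28, 2)], [(26, -1)], [], [], [], [], [], [],
    [], [], [(55, 2)], [], [], [], [], [(55, 2)], [], [(54, 2)], [(62, 2)], [], [(64, -2)],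
    [(66, 2)], [(63, 1)], [], [(65, 1)], [(67, -1)], [], [(57, -1)], [(59, 1)], [], [],
    [(61, 2)], [(55, 1)], [(63, -2)], [], [], [], [], [], [], [(73, -1)], [(75, -1)], [], [],
    [(70, -1)], [], [(71, -1)], [], [(74, -1)]],
  [[(17, 1)], [], [(12, -1)], [(13, 1)], [(21, 1)], [], [(23, 1)], [], [(47, 2)], [],
    [(30, 1), (35, -1), (39, 1)], [(37, -1)], [(29, 2)], [], [(27, 1)], [], [(44, -2)],
    [(40, 2)], [(42, -2), (53, 1)], [(38, -1)], [], [], [(26, -1)], [(25, -2)], [], [], [], [],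
    [], [], [(56, 2)], [], [(62, -2)], [(54, 2)], [(63, 2)], [], [(58, 2)], [], [], [(56, 2)],
    [], [], [(64, 1)], [(57, -1)], [], [(68, -1)], [(65, -1)], [], [(60, 1)], [], [(69, -2)], [],
    [(56, 1)], [(64, -2)], [], [], [], [], [(72, 1)], [(73, -1)], [], [], [], [(70, -1)], [], [],
    [], [(74, -1)], [], [(76, -1)]],
  [[(16, 1)], [], [], [(12, 1)], [(20, -1)], [(13, -1)], [(22, 1)], [], [], [(47, -2)],
    [(43, -2)], [(30, 1), (35, -1), (39, -1), (52, 2)], [], [(29, 2)], [], [(27, -1)], [(49, 2)],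
    [(44, -2)], [(46, 2)], [(53, 1)], [], [], [(28, -2)], [(26, -1)], [], [], [], [], [], [],
    [(57, 2)], [(62, 2)], [(63, -2)], [(55, -2)], [], [], [(59, 2)], [(56, -2)], [(64, 2)], [],
    [], [(68, -2)], [(65, -1)], [], [], [(69, -1)], [], [], [(61, -1)], [], [], [], [(57, 1)],
    [(65, -4)], [], [], [], [], [(73, -1)], [(75, 1)], [], [], [(70, -1)], [], [], [], [(74, 1)],
    [], [(76, -1)]],
  [[], [(17, 1)], [(10, 1)], [(11, -1)], [(19, -1)], [], [], [(23, 1)], [(48, -2)], [],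
    [(36, 2)], [], [(30, -1), (35, 1), (39, 1)], [(37, -1)], [(33, 1)], [], [(45, 2)],
    [(41, -2)], [], [], [(42, -2), (53, 1)], [(38, -1)], [(32, -1)], [(31, -2)], [], [],
    [(62, 2)], [(54, -2)], [(63, -2)], [(56, 2)], [], [], [], [], [], [(58, 2)], [], [], [],
    [(58, 2)], [], [], [(66, 1)], [(59, -1)], [(68, -1)], [], [(67, -1)], [(60, 1)], [],
    [(69, -2)], [], [], [(58, 1)], [(66, -2)], [], [], [(72, -1)], [(73, 1)], [], [], [], [], [],
    [(71, -1)], [], [(74, 1)], [], [], [], [(77, -1)]],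
  [[], [(16, 1)], [], [(10, -1)], [(18, 1)], [(11, 1)], [], [(22, 1)], [], [(48, 2)], [],
    [(36, 2)], [(43, -2)], [(30, -1), (35, 1), (39, -1), (52, 2)], [], [(33, -1)], [(50, -2)],
    [(45, 2)], [], [], [(46, 2)], [(53, 1)], [(34, -2)], [(32, -1)], [], [(62, -2)], [(63, 2)],
    [(55, 2)], [], [(57, 2)], [], [], [], [], [], [(59, 2)], [], [(58, -2)], [(66, 2)], [],
    [(68, -2)], [], [(67, -1)], [], [(69, -1)], [], [], [(61, -1)], [], [], [], [], [(59, 1)],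
    [(67, -4)], [], [], [(73, 1)], [(75, -1)], [], [], [], [], [(71, -1)], [], [(74, -1)], [],
    [], [], [(77, -1)]],
  [[], [], [(8, -1)], [(9, -1)], [(17, 1)], [], [(19, 1)], [(21, 1)], [(51, 2)], [], [(48, 2)],
    [], [(47, 2)], [], [(30, -1), (35, -1), (39, 1), (52, 2)], [(37, 1)], [], [], [(45, 2)],
    [(41, 2)], [(44, 2)], [(40, 2)], [(53, 1)], [(38, -1)], [(54, 2)], [], [(64, 2)], [(56, 2)],
    [(65, 2)], [], [], [], [(66, 2)], [(58, 2)], [(67, 2)], [], [], [], [], [(60, 2)], [], [],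
    [(68, -1)], [(61, 1)], [], [], [(69, -1)], [], [], [], [], [], [(60, 1)], [(68, -4)],
    [(72, 1)], [(73, 1)], [], [], [], [], [], [], [], [(74, -1)], [], [(76, -1)], [], [(77, -1)]],
  [[], [], [], [(8, -1)], [(16, -1)], [(9, -1)], [(18, 1)], [(20, 1)], [], [(51, 2)], [],
    [(48, -2)], [], [(47, -2)], [(43, 2)], [(30, -1), (35, -1), (39, -1), (52, 4)], [], [],
    [(50, 2)], [(45, 2)], [(49, 2)], [(44, 2)], [(46, 2)], [(42, -2), (53, 1)], [(55, 2)],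
    [(64, 2)], [(65, 2)], [(57, -2)], [], [], [], [(66, 2)], [(67, 2)], [(59, -2)], [], [], [],
    [(60, 2)], [(68, 2)], [], [], [], [(69, 1)], [], [], [], [], [], [], [], [], [], [(61, 1)],
    [(69, -2)], [(73, 1)], [(75, 1)], [], [], [], [], [], [], [(74, 1)], [], [(76, -1)], [],
    [(77, -1)]],
  [[(11, -1)], [(13, -1)], [(22, 1)], [(23, 1)], [(15, 1)], [], [], [], [(53, -1)], [(38, 1)],
    [(32, -1)], [(31, 2)], [(26, 1)], [(25, -2)], [], [], [(30, 1), (35, 1), (39, 1), (52, -2)],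
    [(37, 1)], [(33, 1)], [], [(27, -1)], [], [(24, 2)], [], [], [], [], [], [], [], [(62, 2)],
    [], [], [], [], [(62, 2)], [], [], [], [(62, 2)], [], [], [(54, 1)], [(63, 1)], [(56, -1)],
    [(58, 1)], [(55, 1)], [(64, 1)], [(66, -1)], [(57, 2)], [(59, -2)], [(68, 2)], [(62, 1)],
    [(54, 4)], [], [], [], [(70, 1)], [], [(71, 1)], [], [(74, -1)], [], [], [], [], [], [],
    [(72, -1)], [(73, -1)]],
  [[(10, -1)], [(12, -1)], [], [(22, 1)], [(14, -1)], [(23, 1)], [], [], [(46, -2)],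
    [(42, 2), (53, -1)], [(34, 2)], [(32, -1)], [(28, -2)], [(26, 1)], [], [], [(43, 2)],
    [(30, 1), (35, 1), (39, -1)], [], [(33, -1)], [], [(27, 1)], [], [(24, 2)], [], [], [], [],
    [], [], [(63, 2)], [], [], [], [], [(63, 2)], [], [(62, 2)], [(54, -2)], [], [(56, 2)],
    [(58, -2)], [(55, -1)], [], [(57, -1)], [(59, 1)], [], [(65, -1)], [(67, 1)], [], [],
    [(69, 2)], [(63, 1)], [(55, 2)], [], [], [(70, 1)], [], [(71, 1)], [], [(74, 1)], [], [], [],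
    [], [], [], [], [(73, -1)], [(75, -1)]],
  [[(9, -1)], [], [(20, -1)], [(21, 1)], [(13, -1)], [], [(15, -1)], [], [(44, 2)], [(40, -2)],
    [(42, 2), (53, -1)], [(38, 1)], [], [], [(26, 1)], [(25, 2)], [(47, 2)], [],
    [(30, 1), (35, -1), (39, 1)], [(37, -1)], [(29, 2)], [], [(27, 1)], [], [], [], [], [], [],
    [], [(64, 2)], [], [(54, 2)], [(62, 2)], [(55, -2)], [], [(66, 2)], [], [], [(64, 2)], [],
    [], [(56, -1)], [(65, -1)], [], [(60, 1)], [(57, 1)], [], [(68, 1)], [], [(61, 2)], [],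
    [(64, 1)], [(56, 2)], [], [(70, 1)], [], [], [], [(74, 1)], [], [(76, 1)], [], [], [], [],
    [(72, 1)], [(73, -1)]],
  [[(8, -1)], [], [], [(20, 1)], [(12, 1)], [(21, -1)], [(14, -1)], [], [(49, -2)], [(44, 2)],
    [(46, -2)], [(53, -1)], [], [], [(28, 2)], [(26, 1)], [], [(47, -2)], [(43, -2)],
    [(30, 1), (35, -1), (39, -1), (52, 2)], [], [(29, 2)], [], [(27, -1)], [], [], [], [], [],
    [], [(65, 2)], [(54, -2)], [(55, 2)], [(63, -2)], [], [], [(67, 2)], [(64, -2)], [(56, -2)],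
    [], [], [(60, 2)], [(57, 1)], [], [], [(61, 1)], [], [], [(69, -1)], [], [], [], [(65, 1)],
    [(57, 4)], [(70, 1)], [], [], [], [(74, -1)], [], [(76, 1)], [], [], [], [], [], [(73, -1)],
    [(75, 1)]],
  [[], [(9, -1)], [(18, 1)], [(19, -1)], [(11, 1)], [], [], [(15, -1)], [(45, -2)], [(41, 2)],
    [], [], [(42, 2), (53, -1)], [(38, 1)], [(32, 1)], [(31, 2)], [(48, -2)], [], [(36, 2)], [],
    [(30, -1), (35, 1), (39, 1)], [(37, -1)], [(33, 1)], [], [], [], [(54, -2)], [(62, -2)],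
    [(55, 2)], [(64, 2)], [], [], [], [], [], [(66, 2)], [], [], [], [(66, 2)], [], [],
    [(58, -1)], [(67, -1)], [(60, 1)], [], [(59, 1)], [(68, 1)], [], [(61, 2)], [], [],
    [(66, 1)], [(58, 2)], [], [(71, 1)], [], [(74, -1)], [], [], [], [(77, 1)], [], [],
    [(72, -1)], [(73, 1)]],
  [[], [(8, -1)], [], [(18, -1)], [(10, -1)], [(19, 1)], [], [(14, -1)], [(50, 2)], [(45, -2)],
    [], [], [(46, -2)], [(53, -1)], [(34, 2)], [(32, 1)], [], [(48, 2)], [], [(36, 2)],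
    [(43, -2)], [(30, -1), (35, 1), (39, -1), (52, 2)], [], [(33, -1)], [], [(54, 2)],
    [(55, -2)], [(63, 2)], [], [(65, 2)], [], [], [], [], [], [(67, 2)], [], [(66, -2)],
    [(58, -2)], [], [(60, 2)], [], [(59, 1)], [], [(61, 1)], [], [], [(69, -1)], [], [], [], [],
    [(67, 1)], [(59, 4)], [(71, 1)], [], [(74, 1)], [], [], [], [(77, 1)], [], [], [], [(73, 1)],
    [(75, -1)]],
  [[], [], [(16, -1)], [(17, -1)], [(9, -1)], [], [(11, -1)], [(13, -1)], [], [], [(45, -2)],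
    [(41, -2)], [(44, -2)], [(40, -2)], [(53, -1)], [(38, 1)], [(51, 2)], [], [(48, 2)], [],
    [(47, 2)], [], [(30, -1), (35, -1), (39, 1), (52, 2)], [(37, 1)], [(62, 2)], [], [(56, -2)],
    [(64, 2)], [(57, -2)], [], [], [], [(58, -2)], [(66, 2)], [(59, -2)], [], [], [], [],
    [(68, 2)], [], [], [(60, 1)], [(69, 1)], [], [], [(61, 1)], [], [], [], [], [], [(68, 1)],
    [(60, 4)], [], [(74, 1)], [], [(76, 1)], [], [(77, 1)], [], [], [(72, 1)], [(73, 1)]],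
  [[], [], [], [(16, -1)], [(8, 1)], [(17, -1)], [(10, -1)], [(12, -1)], [], [], [(50, -2)],
    [(45, -2)], [(49, -2)], [(44, -2)], [(46, -2)], [(42, 2), (53, -1)], [], [(51, 2)], [],
    [(48, -2)], [], [(47, -2)], [(43, 2)], [(30, -1), (35, -1), (39, -1), (52, 4)], [(63, 2)],
    [(56, -2)], [(57, -2)], [(65, -2)], [], [], [], [(58, -2)], [(59, -2)], [(67, -2)], [], [],
    [], [(68, 2)], [(60, -2)], [], [], [], [(61, -1)], [], [], [], [], [], [], [], [], [],
    [(69, 1)], [(61, 2)], [(74, -1)], [], [(76, 1)], [], [(77, 1)], [], [], [], [(73, 1)],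
    [(75, 1)]]]

/-- Row `r` of the matrix of the `k`-th frame field. -/
def row (k r : ℕ) : List (ℕ × ℤ) := (frameTable.getD k []).getD r []

/-- Row `r` of the product of the matrices `k` and `l`. -/
def rowMul (k l r : ℕ) : List (ℕ × ℤ) :=
  (row k r).flatMap fun e => (row l (e.1 % 78)).map fun e' => (e'.1, e.2 * e'.2)

def coef (l : List (ℕ × ℤ)) (c : ℕ) : ℤ := (l.map fun e => if e.1 = c then e.2 else 0).sum

def isZero (l : List (ℕ × ℤ)) : Bool := l.all fun e => coef l e.1 == 0

def scale (z : ℤ) (l : List (ℕ × ℤ)) : List (ℕ × ℤ) := l.map fun e => (e.1, z * e.2)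

/-- The list of nonzero values `skew i a b`. -/
def skewList (a b : Fin 16) : List (ℕ × ℤ) :=
  ((List.finRange 8).map fun i => (i.val, if partner a i = b then sgn a i else 0)).filter
    fun e => e.2 ≠ 0

theorem rowMul_comm_aux : ∀ a b : Fin 16, b < a → ∀ r : Fin 78,
    isZero (rowMul (8 + a) (8 + b) r ++ scale (-1) (rowMul (8 + b) (8 + a) r) ++
      (skewList b a).flatMap fun e => scale e.2 (row e.1 r)) = true := by
  decide +kernel

abbrev Jet : Type := Fin 78 → ℝ

/-- The value of the linear form with coefficient list `l`. -/
def eval (l : List (ℕ × ℤ)) (v : Jet) : ℝ := (l.map fun e => (e.2 : ℝ) * v (Fin.ofNat 78 e.1)).sum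

theorem eval_append (l l' v) : eval (l ++ l') v = eval l v + eval l' v := by simp [eval]

theorem eval_cons (e l v) : eval (e :: l) v = (e.2 : ℝ) * v (Fin.ofNat 78 e.1) + eval l v := by
  simp [eval]

@[simp] theorem eval_nil (v) : eval [] v = 0 := by simp [eval]

theorem eval_scale (z l v) : eval (scale z l) v = z * eval l v := by
  induction l with
  | nil => simp [eval, scale]
  | cons e l ih =>
    rw [show scale z (e :: l) = (e.1, z * e.2) :: scale z l from rfl, eval_cons, ih, eval_cons]
    push_cast; ring

theorem eval_eq_zero {l} (h : isZero l = true) (v : Jet) : eval l v = 0 := by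
  have key : ∀ (l : List (ℕ × ℤ)) (s : Finset ℕ), (∀ e ∈ l, e.1 ∈ s) →
      eval l v = ∑ c ∈ s, (coef l c : ℝ) * v (Fin.ofNat 78 c) := by
    intro l s hs
    induction l with
    | nil => simp [coef]
    | cons e l ih =>
      rw [eval_cons, ih fun e' he' => hs e' (List.mem_cons_of_mem _ he')]
      have : ∀ c, coef (e :: l) c = (if e.1 = c then e.2 else 0) + coef l c := by
        intro c; simp [coef]
      simp only [this, Int.cast_add, add_mul, Finset.sum_add_distrib]
      congr 1
      rw [Finset.sum_eq_single e.1]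
      · simp
      · intro b _ hb; simp [hb.symm]
      · intro h; exact absurd (hs e (by simp)) h
  rw [key l (l.map Prod.fst).toFinset]
  · refine Finset.sum_eq_zero fun c hc => ?_
    simp only [List.mem_toFinset, List.mem_map] at hc
    obtain ⟨e, he, rfl⟩ := hc
    have := List.all_eq_true.1 h e he
    simp only [beq_iff_eq] at this
    simp [this]
  · intro e he
    simp only [List.mem_toFinset, List.mem_map]
    exact ⟨e, he, rfl⟩

/-- The matrix of the `k`-th frame field acting on jets. -/
def frameOp (k : Fin 24) : Jet →L[ℝ] Jet := LinearMap.toContinuousLinearMap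
  { toFun := fun v r => eval (row k r) v
    map_add' := fun v w => by
      ext r
      simp [eval, mul_add, List.sum_map_add]
    map_smul' := fun t v => by
      ext r
      simp [eval, mul_left_comm, List.sum_map_mul_left] }

theorem frameOp_apply (k v r) : frameOp k v r = eval (row k r) v := rfl

attribute [irreducible] frameOp

theorem eval_rowMul (k l : Fin 24) (v) (r : Fin 78) :
    eval (rowMul k l r) v = (frameOp k * frameOp l) v r := by
  rw [mul_apply_eq_comp, frameOp_apply, rowMul]
  induction row k r with
  | nil => simp
  | cons e t ih =>
    rw [List.flatMap_cons, eval_append, ih, eval_cons, frameOp_apply]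
    congr 1
    exact eval_scale e.2 _ v

/-- The index in the frame of the `i`-th central field. -/
abbrev uIdx (i : Fin 8) : Fin 24 := Fin.castAdd 16 i
/-- The index in the frame of the `b`-th horizontal field. -/
abbrev xIdx (b : Fin 16) : Fin 24 := Fin.natAdd 8 b

theorem eval_flatMap {α : Type*} (l : List α) (f : α → List (ℕ × ℤ)) (v) :
    eval (l.flatMap f) v = (l.map fun e => eval (f e) v).sum := by
  induction l with
  | nil => simp
  | cons e l ih => rw [List.flatMap_cons, eval_append, ih, List.map_cons, List.sum_cons]

theorem sum_skewList (a b : Fin 16) (w : ℕ → ℝ) :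
    ((skewList a b).map fun e => (e.2 : ℝ) * w e.1).sum = ∑ i : Fin 8, (skew i a b : ℝ) * w i := by
  have key : ∀ l : List (ℕ × ℤ), ((l.filter fun e => e.2 ≠ 0).map
      fun e => (e.2 : ℝ) * w e.1).sum = (l.map fun e => (e.2 : ℝ) * w e.1).sum := by
    intro l
    induction l with
    | nil => simp
    | cons e l ih => by_cases h : e.2 = 0 <;> simp_all
  rw [skewList, key, List.map_map, Fin.sum_univ_def]
  rfl

theorem frameOp_comm_XX (a b : Fin 16) : frameOp (xIdx a) * frameOp (xIdx b) -
    frameOp (xIdx b) * frameOp (xIdx a) = -∑ i, (skew i b a : ℝ) • frameOp (uIdx i) := by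
  have lt : ∀ a b : Fin 16, b < a → frameOp (xIdx a) * frameOp (xIdx b) -
    frameOp (xIdx b) * frameOp (xIdx a) = -∑ i, (skew i b a : ℝ) • frameOp (uIdx i) := by
    intro a b h
    ext v r
    have H := eval_eq_zero (rowMul_comm_aux a b h r) v
    rw [eval_append, eval_append, eval_scale] at H
    have e1 := eval_rowMul (xIdx a) (xIdx b) v r
    have e2 := eval_rowMul (xIdx b) (xIdx a) v r
    simp only [xIdx, Fin.val_natAdd] at e1 e2
    rw [e1, e2] at H
    have e3 : eval ((skewList b a).flatMap fun e => scale e.2 (row e.1 r)) v =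
        ∑ i : Fin 8, (skew i b a : ℝ) * frameOp (uIdx i) v r := by
      rw [eval_flatMap]
      simp only [eval_scale, frameOp_apply]
      exact sum_skewList b a fun i => eval (row i r) v
    rw [e3] at H
    simp only [sub_apply, neg_apply, _root_.sum_apply, smul_apply, Pi.sub_apply, Pi.neg_apply,
      Finset.sum_apply, Pi.smul_apply, smul_eq_mul]
    rw [Int.cast_neg, Int.cast_one] at H
    linarith
  rcases lt_trichotomy a b with h | rfl | h
  · rw [← neg_sub, lt b a h, neg_neg, ← Finset.sum_neg_distrib]
    refine Finset.sum_congr rfl fun i _ => ?_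
    rw [skew_antisymm]; push_cast; module
  · have : ∀ i, skew i a a = 0 := fun i => by have := skew_antisymm i a a; omega
    simp [this]
  · exact lt a b h

theorem frameOp_comm_UX (i : Fin 8) (c : Fin 16) :
    frameOp (uIdx i) * frameOp (xIdx c) = frameOp (xIdx c) * frameOp (uIdx i) := by
  have key : ∃ a b, (∀ k, skew k b a = if k = i then 1 else 0) ∧ (∀ k, skew k a c = 0) ∧
      ∀ k, skew k b c = 0 := by
    revert i c; decide +kernel
  obtain ⟨a, b, h1, h2, h3⟩ := key
  have e1 := frameOp_comm_XX a b
  have e2 := frameOp_comm_XX c a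
  have e3 := frameOp_comm_XX c b
  simp only [h1, h2, h3, Int.cast_ite, Int.cast_one, Int.cast_zero, ite_smul, one_smul, zero_smul,
    Finset.sum_ite_eq', Finset.mem_univ, if_true, Finset.sum_const_zero, neg_zero] at e1 e2 e3
  rw [eq_comm, ← sub_eq_zero]
  rw [← neg_eq_iff_eq_neg.2 e1]
  set A := frameOp (xIdx a)
  set B := frameOp (xIdx b)
  set D := frameOp (xIdx c)
  rw [sub_eq_zero] at e2 e3
  have f1 : D * (A * B) = A * B * D := by rw [← mul_assoc, e2, mul_assoc, e3, mul_assoc]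
  have f2 : D * (B * A) = B * A * D := by rw [← mul_assoc, e3, mul_assoc, e2, mul_assoc]
  rw [mul_neg, neg_mul, mul_sub, sub_mul, f1, f2, sub_self]

theorem frameOp_comm_U (i : Fin 8) (k : Fin 24) :
    frameOp (uIdx i) * frameOp k = frameOp k * frameOp (uIdx i) := by
  induction k using Fin.addCases (m := 8) (n := 16) with
  | right c => exact frameOp_comm_UX i c
  | left j =>
    have key : ∃ a b, ∀ k, skew k b a = if k = j then 1 else 0 := by
      revert j; decide +kernel
    obtain ⟨a, b, h1⟩ := key
    have e1 := frameOp_comm_XX a b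
    simp only [h1, Int.cast_ite, Int.cast_one, Int.cast_zero, ite_smul, one_smul, zero_smul,
      Finset.sum_ite_eq', Finset.mem_univ, if_true] at e1
    have e2 := frameOp_comm_UX i a
    have e3 := frameOp_comm_UX i b
    rw [← neg_eq_iff_eq_neg.2 e1]
    set D := frameOp (uIdx i)
    rw [mul_neg, neg_mul, mul_sub, sub_mul, ← mul_assoc, ← mul_assoc, e2, e3, mul_assoc, e3,
      mul_assoc, e2, mul_assoc, mul_assoc]


/-- The grading of the jet space, shifted to start at `0`. -/
def deg (c : Fin 78) : ℕ :=
  if c < 8 then 0 else if c < 24 then 1 else if c < 54 then 2 else if c < 70 then 3 else 4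

/-- The weight of a frame field. -/
def wt (k : Fin 24) : ℕ := if k < 8 then 2 else 1

theorem deg_of_mem_row : ∀ (k : Fin 24) (r : Fin 78), ∀ e ∈ row k r,
    deg (Fin.ofNat 78 e.1) = deg r + wt k := by
  decide +kernel

theorem eval_eq_zero_of_forall {l : List (ℕ × ℤ)} {v : Jet}
    (h : ∀ e ∈ l, v (Fin.ofNat 78 e.1) = 0) : eval l v = 0 := by
  refine List.sum_eq_zero fun x hx => ?_
  obtain ⟨e, he, rfl⟩ := List.mem_map.1 hx
  rw [h e he, mul_zero]

/-- The jets supported in degrees below `m`. -/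
def Below (m : ℕ) (v : Jet) : Prop := ∀ c, m ≤ deg c → v c = 0

theorem below_five (v : Jet) : Below 5 v := by
  intro c h
  have : ∀ c, ¬ 5 ≤ deg c := by decide +kernel
  exact absurd h (this c)

theorem Below.eq_zero {v : Jet} (h : Below 0 v) : v = 0 := funext fun c => h c (Nat.zero_le _)

theorem Below.frameOp {m : ℕ} {v : Jet} (h : Below m v) (k : Fin 24) :
    Below (m - wt k) (frameOp k v) := by
  intro c hc
  rw [frameOp_apply]
  refine eval_eq_zero_of_forall fun e he => h _ ?_
  rw [deg_of_mem_row k c e he]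
  omega

/-- The generic element of the frame algebra, acting on jets. -/
def pencil : Pt →L[ℝ] (Jet →L[ℝ] Jet) :=
  ∑ k, (ContinuousLinearMap.proj (R := ℝ) (φ := fun _ : Fin 24 => ℝ) k).smulRight (frameOp k)

theorem pencil_apply (p : Pt) : pencil p = ∑ k, p k • frameOp k := by
  simp [pencil, _root_.sum_apply]

attribute [irreducible] pencil

theorem pencil_apply_apply (p : Pt) (v : Jet) (r) :
    pencil p v r = ∑ k, p k * eval (row k r) v := by
  simp [pencil_apply, _root_.sum_apply, frameOp_apply]

theorem Below.pencil {m : ℕ} {v : Jet} (h : Below m v) (p : Pt) :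
    Below (m - 1) (pencil p v) := by
  intro c hc
  rw [pencil_apply_apply]
  refine Finset.sum_eq_zero fun k _ => ?_
  rw [← frameOp_apply, h.frameOp k c (le_trans ?_ hc), mul_zero]
  unfold wt
  split_ifs <;> omega

/-- The `i`-th skew form on the horizontal parts. -/
def form (i : Fin 8) (p w : Pt) : ℝ :=
  ∑ a, ∑ b, (skew i a b : ℝ) * p (xIdx a) * w (xIdx b)

/-- The central part of the commutator of two generic elements. -/
def pencilComm (p w : Pt) : Jet →L[ℝ] Jet :=
  -∑ i, form i p w • frameOp (uIdx i)

theorem pencil_split (p : Pt) : pencil p =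
    ∑ i, p (uIdx i) • frameOp (uIdx i) + ∑ a, p (xIdx a) • frameOp (xIdx a) := by
  rw [pencil_apply, Fin.sum_univ_add (a := 8) (b := 16)]

theorem commute_U_pencil (i : Fin 8) (p : Pt) : Commute (frameOp (uIdx i)) (pencil p) := by
  rw [pencil_apply]
  exact Commute.sum_right _ _ _ fun k _ => Commute.smul_right (frameOp_comm_U i k) _

theorem commute_pencilComm (p w q : Pt) : Commute (pencilComm p w) (pencil q) :=
  (Commute.sum_left _ _ _ fun i _ => (commute_U_pencil i q).smul_left _).neg_left

theorem pencil_comm (p w : Pt) :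
    pencil w * pencil p - pencil p * pencil w = pencilComm p w := by
  have h1 : ∀ q : Pt, Commute (∑ i, q (uIdx i) • frameOp (uIdx i)) (pencil p) := fun q =>
    Commute.sum_left _ _ _ fun i _ => (commute_U_pencil i p).smul_left _
  have h2 : Commute (∑ i, p (uIdx i) • frameOp (uIdx i)) (∑ a, w (xIdx a) • frameOp (xIdx a)) :=
    Commute.sum_left _ _ _ fun i _ => Commute.sum_right _ _ _ fun a _ =>
      ((show Commute _ _ from frameOp_comm_UX i a).smul_left _).smul_right _
  have e : pencil w * pencil p - pencil p * pencil w =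
      (∑ b, w (xIdx b) • frameOp (xIdx b)) * (∑ a, p (xIdx a) • frameOp (xIdx a)) -
      (∑ a, p (xIdx a) • frameOp (xIdx a)) * (∑ b, w (xIdx b) • frameOp (xIdx b)) := by
    rw [pencil_split w, add_mul, mul_add, (h1 w).eq, add_sub_add_left_eq_sub, pencil_split p,
      mul_add, add_mul, h2.eq, add_sub_add_left_eq_sub]
  rw [e, pencilComm]
  unfold form
  rw [Finset.sum_mul_sum, Finset.sum_mul_sum, Finset.sum_comm,
    ← Finset.sum_sub_distrib]
  have e2 : ∀ a b : Fin 16, (w (xIdx b) • frameOp (xIdx b)) * (p (xIdx a) • frameOp (xIdx a)) -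
      (p (xIdx a) • frameOp (xIdx a)) * (w (xIdx b) • frameOp (xIdx b)) =
      -∑ i, ((skew i a b : ℝ) * p (xIdx a) * w (xIdx b)) • frameOp (uIdx i) := by
    intro a b
    have := congrArg (fun x => (p (xIdx a) * w (xIdx b)) • x) (frameOp_comm_XX b a)
    simp only [smul_sub, smul_neg, Finset.smul_sum, smul_smul] at this
    rw [smul_mul_smul_comm, smul_mul_smul_comm, mul_comm (w _), this]
    congr 1
    refine Finset.sum_congr rfl fun i _ => ?_
    congr 1; ring
  simp only [← Finset.sum_sub_distrib, e2, Finset.sum_neg_distrib, Finset.sum_smul]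
  congr 1
  symm
  rw [Finset.sum_comm]
  refine Finset.sum_congr rfl fun a _ => Finset.sum_comm

theorem Below.pencilComm {m : ℕ} {v : Jet} (h : Below m v) (p w : Pt) :
    Below (m - 2) (pencilComm p w v) := by
  intro c hc
  simp only [_root_.pencilComm, neg_apply, _root_.sum_apply, smul_apply, Pi.neg_apply,
    Finset.sum_apply, Pi.smul_apply]
  rw [Finset.sum_eq_zero, neg_zero]
  intro i _
  have : wt (uIdx i) = 2 := by revert i; decide
  rw [h.frameOp (uIdx i) c (by rw [this]; exact hc), smul_zero]

/-- The exponential of the generic element. -/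
def pexp (p : Pt) : Jet →L[ℝ] Jet :=
  1 + pencil p + (1 / 2 : ℝ) • (pencil p * pencil p) +
    (1 / 6 : ℝ) • (pencil p * (pencil p * pencil p)) +
    (1 / 24 : ℝ) • (pencil p * (pencil p * (pencil p * pencil p)))

theorem contDiff_pexp : ContDiff ℝ (⊤ : ℕ∞) pexp := by
  have h : ContDiff ℝ (⊤ : ℕ∞) (fun p => pencil p) := pencil.contDiff
  unfold pexp
  exact (((contDiff_const.add h).add ((h.mul h).const_smul _)).add
    ((h.mul (h.mul h)).const_smul _)).add ((h.mul (h.mul (h.mul h))).const_smul _)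

theorem fderiv_pexp (p w : Pt) : fderiv ℝ pexp p w =
    pencil w + (1 / 2 : ℝ) • (pencil w * pencil p + pencil p * pencil w) +
    (1 / 6 : ℝ) • (pencil w * (pencil p * pencil p) +
      pencil p * (pencil w * pencil p + pencil p * pencil w)) +
    (1 / 24 : ℝ) • (pencil w * (pencil p * (pencil p * pencil p)) +
      pencil p * (pencil w * (pencil p * pencil p) +
      pencil p * (pencil w * pencil p + pencil p * pencil w))) := by
  have h : HasFDerivAt (fun p => pencil p) pencil p := pencil.hasFDerivAt
  have h2 := h.mul' h
  have h3 := h.mul' h2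
  have h4 := h.mul' h3
  have H := ((((hasFDerivAt_const (1 : Jet →L[ℝ] Jet) p).add h).add
    (h2.const_smul (1 / 2 : ℝ))).add (h3.const_smul (1 / 6 : ℝ))).add (h4.const_smul (1 / 24 : ℝ))
  have e : fderiv ℝ pexp p = _ := HasFDerivAt.fderiv H
  rw [e]
  simp [mul_add, mul_assoc]
  module

section Nilpotent
variable (p w : Pt)

theorem pencil_five (q : Fin 5 → Pt) : pencil (q 0) * (pencil (q 1) * (pencil (q 2) *
    (pencil (q 3) * pencil (q 4)))) = 0 := by
  refine ContinuousLinearMap.ext fun v => Below.eq_zero ?_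
  exact (((((below_five v).pencil (q 4)).pencil (q 3)).pencil (q 2)).pencil (q 1)).pencil (q 0)

theorem pencil_three_comm : pencil p * (pencil p * (pencil p * pencilComm p w)) = 0 := by
  refine ContinuousLinearMap.ext fun v => Below.eq_zero ?_
  exact ((((below_five v).pencilComm p w).pencil p).pencil p).pencil p

theorem fderiv_pexp_right :
    fderiv ℝ pexp p w = pexp p * (pencil w + (1 / 2 : ℝ) • pencilComm p w) := by
  have z1 := pencil_five ![p, p, p, p, w]
  have z3 := pencil_three_comm p w
  have hC := (commute_pencilComm p w p).eq
  have hBA := sub_eq_iff_eq_add'.1 (pencil_comm p w)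
  rw [fderiv_pexp, pexp]
  simp only [Matrix.cons_val] at z1
  generalize pencil p = A at *
  generalize pencil w = B at *
  generalize pencilComm p w = C at *
  have hC' : ∀ x, C * (A * x) = A * (C * x) := fun x => by rw [← mul_assoc, hC, mul_assoc]
  have hBA' : ∀ x, B * (A * x) = A * (B * x) + C * x := fun x => by
    rw [← mul_assoc, hBA, add_mul, mul_assoc]
  simp only [mul_add, add_mul, mul_assoc, smul_mul_assoc, mul_smul_comm, smul_add, hBA, hBA', hC,
    hC', z1, z3, one_mul, smul_zero, add_zero, mul_zero]
  module

theorem fderiv_pexp_left :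
    fderiv ℝ pexp p w = (pencil w - (1 / 2 : ℝ) • pencilComm p w) * pexp p := by
  have z1 := pencil_five ![p, p, p, p, w]
  have z3 := pencil_three_comm p w
  have hC := (commute_pencilComm p w p).eq
  have hBA := sub_eq_iff_eq_add'.1 (pencil_comm p w)
  rw [fderiv_pexp, pexp]
  simp only [Matrix.cons_val] at z1
  generalize pencil p = A at *
  generalize pencil w = B at *
  generalize pencilComm p w = C at *
  have hC' : ∀ x, C * (A * x) = A * (C * x) := fun x => by rw [← mul_assoc, hC, mul_assoc]
  have hBA' : ∀ x, B * (A * x) = A * (B * x) + C * x := fun x => by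
    rw [← mul_assoc, hBA, add_mul, mul_assoc]
  simp only [mul_add, sub_mul, smul_mul_assoc, mul_smul_comm, smul_add, hBA, hBA', hC,
    hC', z1, z3, mul_one, smul_zero, add_zero, mul_zero]
  module

end Nilpotent

/-- The grading operator. -/
def degOp : Jet →L[ℝ] Jet := LinearMap.toContinuousLinearMap
  { toFun := fun v c => ((deg c : ℝ) - 2) * v c
    map_add' := fun v w => by ext c; simp [mul_add]
    map_smul' := fun t v => by ext c; simp [mul_left_comm] }

theorem degOp_apply (v c) : degOp v c = ((deg c : ℝ) - 2) * v c := rfl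

/-- The generator of the weighted dilations. -/
def dilation (p : Pt) : Pt := fun k => wt k * p k

theorem pencil_dilation (p : Pt) :
    pencil (dilation p) = pencil p * degOp - degOp * pencil p := by
  ext v r
  simp only [sub_apply, mul_apply_eq_comp, Pi.sub_apply, pencil_apply_apply, degOp_apply,
    Finset.mul_sum, ← Finset.sum_sub_distrib]
  refine Finset.sum_congr rfl fun k _ => ?_
  have key : ∀ l : List (ℕ × ℤ), (∀ e ∈ l, deg (Fin.ofNat 78 e.1) = deg r + wt k) →
      eval l (degOp v) = ((deg r : ℝ) + wt k - 2) * eval l v := by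
    intro l hl
    induction l with
    | nil => simp
    | cons e l ih =>
      rw [eval_cons, eval_cons, ih fun e he => hl e (List.mem_cons_of_mem _ he), degOp_apply,
        hl e (by simp)]
      push_cast; ring
  rw [key _ (deg_of_mem_row k r), dilation]
  ring

theorem fderiv_pexp_dilation (p : Pt) :
    fderiv ℝ pexp p (dilation p) = pexp p * degOp - degOp * pexp p := by
  rw [fderiv_pexp, pencil_dilation, pexp]
  generalize pencil p = A
  generalize degOp = D
  simp only [mul_add, add_mul, mul_sub, sub_mul, mul_assoc, smul_mul_assoc, mul_smul_comm,
    smul_add, smul_sub, mul_one, one_mul]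
  module

theorem form_eq (i : Fin 8) (p w : Pt) :
    form i p w = ∑ a, (sgn a i : ℝ) * p (xIdx a) * w (xIdx (partner a i)) := by
  unfold form skew
  refine Finset.sum_congr rfl fun a _ => ?_
  rw [Finset.sum_eq_single (partner a i)]
  · simp
  · intro b _ hb; simp [hb.symm]
  · simp

/-- The skew forms, as a vector-valued bilinear map with values in the centre. -/
def torsion : Pt →L[ℝ] Pt →L[ℝ] Pt := LinearMap.toContinuousBilinearMap <|
  LinearMap.mk₂ ℝ (fun p w => Fin.addCases (m := 8) (n := 16) (motive := fun _ => ℝ)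
      (fun i => form i p w) (fun _ => 0))
    (fun p q w => by
      ext k
      induction k using Fin.addCases (m := 8) (n := 16) with
      | left i => simp [form, mul_add, add_mul, Finset.sum_add_distrib]
      | right b => simp)
    (fun t p w => by
      ext k
      induction k using Fin.addCases (m := 8) (n := 16) with
      | left i => simp [form, Finset.mul_sum, mul_assoc, mul_left_comm]
      | right b => simp)
    (fun p q w => by
      ext k
      induction k using Fin.addCases (m := 8) (n := 16) with
      | left i => simp [form, mul_add, Finset.sum_add_distrib]
      | right b => simp)
    (fun t p w => by
      ext k
      induction k using Fin.addCases (m := 8) (n := 16) with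
      | left i => simp [form, Finset.mul_sum, mul_left_comm]
      | right b => simp)

theorem torsion_apply (p w : Pt) : torsion p w = fun k =>
    Fin.addCases (m := 8) (n := 16) (motive := fun _ => ℝ) (fun i => form i p w) (fun _ => 0) k :=
  rfl

theorem torsion_uIdx (p w : Pt) (i) : torsion p w (uIdx i) = form i p w := by
  rw [torsion_apply]; exact Fin.addCases_left i

theorem torsion_xIdx (p w : Pt) (b) : torsion p w (xIdx b) = 0 := by
  rw [torsion_apply]; exact Fin.addCases_right b

theorem Pt.ext_idx {v w : Pt} (hu : ∀ i, v (uIdx i) = w (uIdx i))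
    (hx : ∀ b, v (xIdx b) = w (xIdx b)) : v = w := by
  ext k
  induction k using Fin.addCases (m := 8) (n := 16) with
  | left i => exact hu i
  | right b => exact hx b

theorem torsion_congr {p q v w : Pt} (h : ∀ b, p (xIdx b) = q (xIdx b))
    (h' : ∀ b, v (xIdx b) = w (xIdx b)) : torsion p v = torsion q w := by
  refine Pt.ext_idx (fun i => ?_) fun b => ?_
  · simp [torsion_uIdx, form, h, h']
  · simp [torsion_xIdx]

theorem torsion_skew (p w : Pt) : torsion p w = -torsion w p := by
  refine Pt.ext_idx (fun i => ?_) fun b => ?_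
  · rw [torsion_uIdx, Pi.neg_apply, torsion_uIdx, form, form, Finset.sum_comm,
      ← Finset.sum_neg_distrib]
    refine Finset.sum_congr rfl fun a _ => ?_
    rw [← Finset.sum_neg_distrib]
    refine Finset.sum_congr rfl fun b _ => ?_
    rw [skew_antisymm]; push_cast; ring
  · simp [torsion_xIdx]

theorem torsion_self (p : Pt) : torsion p p = 0 := by
  have := torsion_skew p p
  ext k
  have := congrFun this k
  simp only [Pi.neg_apply, Pi.zero_apply] at this ⊢
  linarith

theorem torsion_zero_of_central {p : Pt} (h : ∀ b, p (xIdx b) = 0) (w : Pt) :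
    torsion p w = 0 := by
  rw [torsion_congr (q := 0) (w := w) (by simpa using h) fun _ => rfl, map_zero]; rfl

theorem torsion_torsion_left (p w q : Pt) : torsion (torsion p w) q = 0 :=
  torsion_zero_of_central (torsion_xIdx p w) q

theorem torsion_torsion_right (p w q : Pt) : torsion q (torsion p w) = 0 := by
  rw [torsion_skew, torsion_torsion_left, neg_zero]

theorem pencil_torsion (p w : Pt) : pencil (torsion p w) = -pencilComm p w := by
  rw [pencil_split, pencilComm, neg_neg]
  simp [torsion_uIdx, torsion_xIdx]

/-- The components of a tangent vector in the left-invariant frame. -/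
def coframe (p v : Pt) : Pt := v + (1 / 2 : ℝ) • torsion p v

/-- The tangent vector with given components in the left-invariant frame. -/
def lift (p w : Pt) : Pt := w - (1 / 2 : ℝ) • torsion p w

/-- The right-invariant field with a given value at the origin. -/
def rightField (w p : Pt) : Pt := w + (1 / 2 : ℝ) • torsion p w

theorem coframe_lift (p w : Pt) : coframe p (lift p w) = w := by
  simp [coframe, lift, torsion_torsion_right]

theorem lift_coframe (p w : Pt) : lift p (coframe p w) = w := by
  simp [coframe, lift, torsion_torsion_right]

theorem torsion_lift_left (p w q : Pt) : torsion (lift p w) q = torsion w q := by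
  simp [lift, torsion_torsion_left]

theorem torsion_coframe_right (p w q : Pt) : torsion q (coframe p w) = torsion q w := by
  simp [coframe, torsion_torsion_right]

theorem lift_apply_xIdx (p w : Pt) (b) : lift p w (xIdx b) = w (xIdx b) := by
  simp [lift, torsion_xIdx]

theorem lam_eq (p v : Pt) (i : Fin 8) : lam p v i = coframe p v (uIdx i) := by
  rw [coframe, Pi.add_apply, Pi.smul_apply, torsion_uIdx, form_eq]
  have hs : ∀ a i, (sgn a i : ℝ) = (((skewTable.getD a []).getD i (0, 0)).2 : ℤ) := fun _ _ => rfl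
  have h9 : ∀ x : Fin 16, x = 1 → v (Fin.natAdd 8 x) = v 9 := by rintro _ rfl; rfl
  fin_cases i <;>
  · simp [lam, Fin.sum_univ_succ, hs, partner, skewTable, uIdx, xIdx]
    first | ring1 | (rw [h9 _ ?_]; ring1; rfl)

theorem pencil_lift (p w : Pt) : pencil (lift p w) = pencil w + (1 / 2 : ℝ) • pencilComm p w := by
  simp [lift, pencil_torsion]

theorem fderiv_pexp_lift (p w : Pt) : fderiv ℝ pexp p (lift p w) = pencil w * pexp p := by
  rw [fderiv_pexp_left, pencil_lift, pencilComm, pencilComm]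
  have : ∀ i, form i p (lift p w) = form i p w := fun i => by
    simp [form, lift_apply_xIdx]
  simp [this]

theorem contDiff_coframe {Y : Pt → Pt} (h : ContDiff ℝ (⊤ : ℕ∞) Y) :
    ContDiff ℝ (⊤ : ℕ∞) fun p => coframe p (Y p) :=
  h.add ((torsion.isBoundedBilinearMap.contDiff.comp (contDiff_id.prodMk h)).const_smul _)

theorem contDiff_lift {Y : Pt → Pt} (h : ContDiff ℝ (⊤ : ℕ∞) Y) :
    ContDiff ℝ (⊤ : ℕ∞) fun p => lift p (Y p) :=
  h.sub ((torsion.isBoundedBilinearMap.contDiff.comp (contDiff_id.prodMk h)).const_smul _)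

theorem fderiv_coframe {Y : Pt → Pt} (h : Differentiable ℝ Y) (p w : Pt) :
    fderiv ℝ (fun p => coframe p (Y p)) p w =
      coframe p (fderiv ℝ Y p w) + (1 / 2 : ℝ) • torsion w (Y p) := by
  have h1 := (h p).hasFDerivAt
  have h2 := h1.add ((torsion.hasFDerivAt_of_bilinear (hasFDerivAt_id p) h1).const_smul (1 / 2 : ℝ))
  have e : fderiv ℝ (fun p => coframe p (Y p)) p = _ := HasFDerivAt.fderiv h2
  rw [e, coframe]
  simp [add_assoc]

theorem coframe_vfBracket {X Y : Pt → Pt} (hX : Differentiable ℝ X) (hY : Differentiable ℝ Y)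
    (p : Pt) : coframe p (vfBracket Y X p) = fderiv ℝ (fun p => coframe p (X p)) p (Y p) -
      fderiv ℝ (fun p => coframe p (Y p)) p (X p) + torsion (X p) (Y p) := by
  rw [fderiv_coframe hX, fderiv_coframe hY, vfBracket, torsion_skew (Y p)]
  simp only [coframe, map_sub]
  module

theorem mem_symH_iff {Y : Pt → Pt} : Y ∈ symH ↔ ContDiff ℝ (⊤ : ℕ∞) Y ∧
    ∀ p w : Pt, (∀ i, w (uIdx i) = 0) → ∀ i,
      fderiv ℝ (fun p => coframe p (Y p)) p (lift p w) (uIdx i) =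
        form i w (coframe p (Y p)) := by
  refine and_congr_right fun hY => ?_
  have key : ∀ X : Pt → Pt, IsSectionH X → ∀ p i, lam p (vfBracket Y X p) i =
      form i (X p) (Y p) - fderiv ℝ (fun p => coframe p (Y p)) p (X p) (uIdx i) := by
    intro X hX p i
    rw [lam_eq, coframe_vfBracket (hX.1.differentiable (by simp)) (hY.differentiable (by simp))]
    have h0 : fderiv ℝ (fun p => coframe p (X p)) p (Y p) (uIdx i) = 0 := by
      have hd : DifferentiableAt ℝ (fun p => coframe p (X p)) p :=
        (contDiff_coframe hX.1).differentiable (by simp) p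
      have e1 := fderiv_apply (𝕜 := ℝ) hd (uIdx i)
      have e2 : (fun p => coframe p (X p) (uIdx i)) = fun _ => 0 := by
        ext p; rw [← lam_eq, hX.2]
      rw [e2] at e1
      have := congrArg (fun L => L (Y p)) e1
      simpa using this.symm
    rw [Pi.add_apply, Pi.sub_apply, h0, torsion_uIdx]
    ring
  constructor
  · intro h p w hw i
    have hX : IsSectionH fun q => lift q w :=
      ⟨contDiff_lift contDiff_const, fun q j => by rw [lam_eq, coframe_lift, hw]⟩
    have := h _ hX p i
    rw [key _ hX] at this
    rw [← sub_eq_zero.1 this, ← torsion_uIdx, ← torsion_uIdx, torsion_lift_left,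
      torsion_coframe_right]
  · intro h X hX p i
    have := h p (coframe p (X p)) (fun j => by rw [← lam_eq, hX.2]) i
    rw [key X hX, ← lift_coframe p (X p), this, ← torsion_uIdx, ← torsion_uIdx, torsion_lift_left,
      torsion_coframe_right, sub_self]

/-- The coordinate of a jet corresponding to a frame index. -/
abbrev jetIdx (k : Fin 24) : Fin 78 := Fin.castLE (by norm_num) k

/-- The frame components of a jet. -/
def jetRes : Jet →L[ℝ] Pt := LinearMap.toContinuousLinearMap
  { toFun := fun v k => v (jetIdx k)
    map_add' := fun _ _ => rfl
    map_smul' := fun _ _ => rfl }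

theorem jetRes_apply (v : Jet) (k) : jetRes v k = v (jetIdx k) := rfl

/-- The jet with given frame components and no higher terms. -/
def jetIncl : Pt →L[ℝ] Jet := LinearMap.toContinuousLinearMap
  { toFun := fun z c => if h : (c : ℕ) < 24 then z ⟨c, h⟩ else 0
    map_add' := fun _ _ => by ext c; by_cases h : (c : ℕ) < 24 <;> simp [h]
    map_smul' := fun _ _ => by ext c; by_cases h : (c : ℕ) < 24 <;> simp [h] }

theorem jetIncl_jetIdx (z : Pt) (k) : jetIncl z (jetIdx k) = z k := by
  have : jetIncl z (jetIdx k) = if h : (k : ℕ) < 24 then z ⟨k, h⟩ else 0 := rfl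
  rw [this, dif_pos k.2]

theorem jetRes_jetIncl (z : Pt) : jetRes (jetIncl z) = z := funext fun k => jetIncl_jetIdx z k

theorem below_jetIncl (z : Pt) : Below 2 (jetIncl z) := by
  intro c hc
  have : ∀ c, 2 ≤ deg c → ¬ (c : ℕ) < 24 := by decide +kernel
  exact dif_neg (this c hc)

theorem wt_uIdx (i : Fin 8) : wt (uIdx i) = 2 := by revert i; decide

theorem wt_xIdx (b : Fin 16) : wt (xIdx b) = 1 := by revert b; decide

theorem row_xIdx_uIdx : ∀ (b : Fin 16) (i : Fin 8), row (xIdx b) (jetIdx (uIdx i)) =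
    if sgn b i = 0 then [] else [((jetIdx (xIdx (partner b i)) : ℕ), sgn b i)] := by
  decide +kernel

theorem frameOp_xIdx_uIdx (b : Fin 16) (i : Fin 8) (v : Jet) :
    frameOp (xIdx b) v (jetIdx (uIdx i)) =
      (sgn b i : ℝ) * jetRes v (xIdx (partner b i)) := by
  rw [frameOp_apply, row_xIdx_uIdx]
  split_ifs with h
  · simp [h]
  · rw [eval_cons, eval_nil, Fin.ofNat_val_eq_self, add_zero, jetRes_apply]

theorem pencil_uIdx {w : Pt} (hw : ∀ i, w (uIdx i) = 0) (v : Jet) (i : Fin 8) :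
    pencil w v (jetIdx (uIdx i)) = form i w (jetRes v) := by
  rw [pencil_split, form_eq]
  simp [hw, _root_.sum_apply, frameOp_xIdx_uIdx, mul_left_comm, mul_assoc]

theorem pencil_jetIncl (p z : Pt) : pencil p (jetIncl z) = jetIncl (torsion p z) := by
  ext c
  have h1 := (below_jetIncl z).pencil p
  by_cases hc : (c : ℕ) < 8
  · obtain ⟨i, rfl⟩ : ∃ i : Fin 8, c = jetIdx (uIdx i) := ⟨⟨c, hc⟩, rfl⟩
    rw [jetIncl_jetIdx, torsion_uIdx, pencil_split]
    have h2 : ∀ i, frameOp (uIdx i) (jetIncl z) = 0 := fun i =>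
      Below.eq_zero <| by simpa only [wt_uIdx] using (below_jetIncl z).frameOp (uIdx i)
    simp [h2, _root_.sum_apply, frameOp_xIdx_uIdx, form_eq, jetRes_jetIncl, mul_left_comm,
      mul_assoc]
  · have h3 : 1 ≤ deg c := by
      have : ∀ c : Fin 78, ¬ (c : ℕ) < 8 → 1 ≤ deg c := by decide +kernel
      exact this c hc
    rw [h1 c h3]
    by_cases hc' : (c : ℕ) < 24
    · have h4 : c = jetIdx (xIdx ⟨c - 8, by omega⟩) := by
        ext; simp; omega
      rw [h4, jetIncl_jetIdx, torsion_xIdx]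
    · exact (below_jetIncl _ c (by
        have : ∀ c : Fin 78, ¬ (c : ℕ) < 24 → 2 ≤ deg c := by decide +kernel
        exact this c hc')).symm

theorem pexp_zero : pexp 0 = 1 := by simp [pexp]

theorem pexp_jetIncl (p z : Pt) : pexp p (jetIncl z) = jetIncl (z + torsion p z) := by
  simp [pexp, pencil_jetIncl, torsion_torsion_right]

theorem fderiv_pexp_apply (v : Jet) (p w : Pt) :
    fderiv ℝ (fun p => pexp p v) p w = fderiv ℝ pexp p w v := by
  have h : HasFDerivAt pexp (fderiv ℝ pexp p) p :=
    (contDiff_pexp.differentiable (by simp) p).hasFDerivAt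
  have e : fderiv ℝ (fun p => pexp p v) p = _ := (h.clm_apply (hasFDerivAt_const v p)).fderiv
  simp [e]

theorem contDiff_pexp_apply (v : Jet) : ContDiff ℝ (⊤ : ℕ∞) fun p => pexp p v :=
  contDiff_pexp.clm_apply contDiff_const

theorem fderiv_jetRes_pexp (v : Jet) (p w : Pt) :
    fderiv ℝ (fun p => jetRes (pexp p v)) p w = jetRes (fderiv ℝ pexp p w v) := by
  have h := ((contDiff_pexp_apply v).differentiable (by simp) p).hasFDerivAt
  have e : fderiv ℝ (fun p => jetRes (pexp p v)) p = _ :=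
    (jetRes.hasFDerivAt.comp p h).fderiv
  rw [e, ContinuousLinearMap.comp_apply, fderiv_pexp_apply]

/-- The symmetry with a given jet at the origin. -/
def symField : Jet →ₗ[ℝ] (Pt → Pt) where
  toFun v p := lift p (jetRes (pexp p v))
  map_add' v w := by ext1 p; simp [lift]; module
  map_smul' t v := by ext1 p; simp [lift]; module

theorem symField_apply (v : Jet) (p : Pt) : symField v p = lift p (jetRes (pexp p v)) := rfl

theorem coframe_symField (v : Jet) (p : Pt) : coframe p (symField v p) = jetRes (pexp p v) := by
  rw [symField_apply, coframe_lift]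

theorem contDiff_symField (v : Jet) : ContDiff ℝ (⊤ : ℕ∞) (symField v) :=
  contDiff_lift (jetRes.contDiff.comp (contDiff_pexp_apply v))

theorem symField_mem (v : Jet) : symField v ∈ symH := by
  rw [mem_symH_iff]
  refine ⟨contDiff_symField v, fun p w hw i => ?_⟩
  simp only [coframe_symField]
  rw [fderiv_jetRes_pexp, fderiv_pexp_lift, mul_apply_eq_comp, jetRes_apply, pencil_uIdx hw]

theorem symField_jetIncl (z : Pt) : symField (jetIncl z) = rightField z := by
  ext1 p
  rw [symField_apply, pexp_jetIncl, jetRes_jetIncl]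
  simp [lift, rightField, torsion_torsion_right]
  module

theorem contDiff_rightField (w : Pt) : ContDiff ℝ (⊤ : ℕ∞) (rightField w) := by
  rw [← symField_jetIncl]; exact contDiff_symField _

theorem eq_of_coframe_eq {X Y : Pt → Pt} (h : ∀ p, coframe p (X p) = coframe p (Y p)) : X = Y := by
  ext1 p
  rw [← lift_coframe p (X p), h, lift_coframe]

theorem fderiv_pexp_rightField (p w : Pt) :
    fderiv ℝ pexp p (rightField w p) = pexp p * pencil w := by
  have h : pencilComm p (rightField w p) = -pencil (torsion p w) := by
    rw [← neg_eq_iff_eq_neg.2 (pencil_torsion _ _), rightField, map_add, map_smul, torsion_torsion_right, smul_zero,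
      add_zero]
  rw [fderiv_pexp_right, h, rightField, map_add, map_smul]
  congr 1
  module

theorem vfBracket_rightField (w : Pt) (v : Jet) :
    vfBracket (rightField w) (symField v) = symField (pencil w v) := by
  refine eq_of_coframe_eq fun p => ?_
  rw [coframe_vfBracket ((contDiff_symField v).differentiable (by simp))
    ((contDiff_rightField w).differentiable (by simp))]
  simp only [coframe_symField]
  have e2 : ∀ p, coframe p (rightField w p) = w + torsion p w := fun p => by
    simp [coframe, rightField, torsion_torsion_right]; module
  have e3 : ∀ u, fderiv ℝ (fun p => w + torsion p w) p u = torsion u w := fun u => by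
    rw [fderiv_const_add]
    have h : HasFDerivAt (fun p => torsion p w) _ p :=
      torsion.hasFDerivAt.clm_apply (hasFDerivAt_const w p)
    rw [h.fderiv]; simp
  simp only [e2, e3]
  rw [fderiv_jetRes_pexp, fderiv_pexp_rightField, rightField]
  simp [torsion_torsion_right, mul_apply_eq_comp]

theorem dilation_add (v w : Pt) : dilation (v + w) = dilation v + dilation w := by
  ext k; simp [dilation, mul_add]

theorem dilation_smul (t : ℝ) (v : Pt) : dilation (t • v) = t • dilation v := by
  ext k; simp [dilation, mul_left_comm]

theorem dilation_torsion (p w : Pt) : dilation (torsion p w) = (2 : ℝ) • torsion p w := by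
  refine Pt.ext_idx (fun i => ?_) fun b => ?_
  · simp [dilation, wt_uIdx]
  · simp [dilation, torsion_xIdx]

theorem torsion_dilation (p w : Pt) : torsion p (dilation w) = torsion p w :=
  torsion_congr (fun _ => rfl) fun b => by simp [dilation, wt_xIdx]

theorem coframe_dilation (p : Pt) : coframe p (dilation p) = dilation p := by
  simp [coframe, torsion_dilation, torsion_self]

theorem jetRes_degOp (v : Jet) : jetRes (degOp v) = -dilation (jetRes v) := by
  ext k
  have : ∀ k, deg (jetIdx k) + wt k = 2 := by decide
  have h : (deg (jetIdx k) : ℝ) + wt k = 2 := mod_cast this k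
  rw [Pi.neg_apply, dilation, jetRes_apply, jetRes_apply, degOp_apply, ← h]
  ring

theorem fderiv_dilation (p w : Pt) : fderiv ℝ dilation p w = dilation w := by
  let L : Pt →ₗ[ℝ] Pt := ⟨⟨dilation, dilation_add⟩, dilation_smul⟩
  exact congrArg (fun M => M w) (L.toContinuousLinearMap.fderiv (x := p))

theorem contDiff_dilation : ContDiff ℝ (⊤ : ℕ∞) dilation := by
  let L : Pt →ₗ[ℝ] Pt := ⟨⟨dilation, dilation_add⟩, dilation_smul⟩
  exact L.toContinuousLinearMap.contDiff

theorem vfBracket_dilation (v : Jet) :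
    vfBracket dilation (symField v) = symField (degOp v) := by
  refine eq_of_coframe_eq fun p => ?_
  rw [coframe_vfBracket ((contDiff_symField v).differentiable (by simp))
    (contDiff_dilation.differentiable (by simp))]
  simp only [coframe_symField, coframe_dilation]
  rw [fderiv_jetRes_pexp, fderiv_pexp_dilation, fderiv_dilation, symField_apply, torsion_dilation,
    torsion_lift_left, torsion_skew]
  simp only [sub_apply, mul_apply_eq_comp, map_sub, jetRes_degOp]
  rw [lift, sub_eq_add_neg (jetRes (pexp p v)), ← neg_smul, dilation_add, dilation_smul, dilation_torsion]
  module

theorem vfBracket_antisymm (X Y : Pt → Pt) : vfBracket X Y = -vfBracket Y X := by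
  ext1 p; simp [vfBracket]

/-- The jet of the grading element. -/
def gradingJet : Jet := fun c => ((if (c : ℕ) ∈ [30, 35, 39, 52] then 1 else 0 : ℤ) : ℝ)

theorem frameOp_gradingJet (k : Fin 24) : frameOp k gradingJet = jetIncl (Pi.single k (wt k : ℝ)) := by
  have key : ∀ (k : Fin 24) (r : Fin 78), ((row k r).map fun e =>
      e.2 * if ((Fin.ofNat 78 e.1 : Fin 78) : ℕ) ∈ [30, 35, 39, 52] then 1 else 0).sum =
      if (r : ℕ) = k then (wt k : ℤ) else 0 := by
    decide +kernel
  ext r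
  have h : frameOp k gradingJet r = (((row k r).map fun e =>
      e.2 * if ((Fin.ofNat 78 e.1 : Fin 78) : ℕ) ∈ [30, 35, 39, 52] then 1 else 0).sum : ℤ) := by
    rw [frameOp_apply, eval, Int.cast_list_sum, List.map_map]
    congr 1
    refine List.map_congr_left fun e _ => ?_
    simp [gradingJet]
  rw [h, key]
  by_cases hr : (r : ℕ) < 24
  · obtain ⟨l, rfl⟩ : ∃ l : Fin 24, r = jetIdx l := ⟨⟨r, hr⟩, rfl⟩
    rw [jetIncl_jetIdx, Pi.single_apply]
    simp [Fin.ext_iff]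
  · have : (jetIncl (Pi.single k (wt k : ℝ))) r = 0 := dif_neg hr
    rw [this, if_neg (by omega), Int.cast_zero]

theorem pencil_gradingJet (p : Pt) : pencil p gradingJet = jetIncl (dilation p) := by
  rw [pencil_apply, _root_.sum_apply]
  simp only [smul_apply, frameOp_gradingJet, ← map_smul, ← map_sum]
  congr 1
  ext k
  simp [dilation, Pi.single_apply, mul_comm]

theorem symField_gradingJet : symField gradingJet = dilation := by
  ext1 p
  have h : jetRes gradingJet = 0 := by
    ext k
    have : ∀ k, (jetIdx k : ℕ) ∉ [30, 35, 39, 52] := by decide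
    simp only [jetRes_apply, gradingJet, if_neg (this k), Int.cast_zero, Pi.zero_apply]
  rw [symField_apply]
  simp [pexp, pencil_gradingJet, pencil_jetIncl, torsion_dilation, torsion_self, h,
    jetRes_jetIncl, lift]

/-- The smooth functions. -/
def smooth : Submodule ℝ (Pt → ℝ) where
  carrier := {h : Pt → ℝ | ContDiff ℝ (⊤ : ℕ∞) h}
  add_mem' {h h'} hh hh' := by
    simp only [Set.mem_ofPred_eq] at *
    exact hh.add hh'
  zero_mem' := by
    simp only [Set.mem_ofPred_eq] at *
    exact contDiff_const (c := (0:ℝ))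
  smul_mem' t h hh := by
    simp only [Set.mem_ofPred_eq] at *
    exact contDiff_const.smul hh

theorem mem_smooth {h : Pt → ℝ} : h ∈ smooth ↔ ContDiff ℝ (⊤ : ℕ∞) h := Iff.rfl

theorem smooth_contDiff (h : smooth) : ContDiff ℝ (⊤ : ℕ∞) (h : Pt → ℝ) := mem_smooth.1 h.2

theorem smooth_differentiable (h : smooth) : Differentiable ℝ (h : Pt → ℝ) :=
  (smooth_contDiff h).differentiable (by simp)

theorem contDiff_fderiv_lift {h : Pt → ℝ} (hh : ContDiff ℝ (⊤ : ℕ∞) h) (w : Pt) :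
    ContDiff ℝ (⊤ : ℕ∞) fun p => fderiv ℝ h p (lift p w) :=
  (hh.fderiv_right (m := (⊤ : ℕ∞)) (by simp)).clm_apply (contDiff_lift contDiff_const)

/-- The derivative along a left-invariant field. -/
def frameDer (w : Pt) : smooth →ₗ[ℝ] smooth where
  toFun h := ⟨fun p => fderiv ℝ h p (lift p w), mem_smooth.2 (contDiff_fderiv_lift (smooth_contDiff h) w)⟩
  map_add' h h' := by
    ext p
    simp [fderiv_add (smooth_differentiable h p) (smooth_differentiable h' p)]
  map_smul' t h := by
    ext p
    simp [fderiv_const_smul (smooth_differentiable h p)]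

theorem frameDer_apply (w : Pt) (h : smooth) (p : Pt) :
    (frameDer w h : Pt → ℝ) p = fderiv ℝ h p (lift p w) := rfl

theorem frameDer_comm (v w : Pt) (h : smooth) :
    frameDer v (frameDer w h) - frameDer w (frameDer v h) =
      -frameDer (torsion v w) h := by
  have h2 : ∀ p, DifferentiableAt ℝ (fderiv ℝ (h : Pt → ℝ)) p :=
    ((smooth_contDiff h).fderiv_right (m := (⊤ : ℕ∞)) (by simp)).differentiable (by simp)
  have key : ∀ (w u : Pt) p, fderiv ℝ (fun p => fderiv ℝ (h : Pt → ℝ) p (lift p w)) p u =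
      fderiv ℝ (fderiv ℝ (h : Pt → ℝ)) p u (lift p w) -
        (1 / 2 : ℝ) * fderiv ℝ (h : Pt → ℝ) p (torsion u w) := by
    intro w u p
    have hl : HasFDerivAt (fun p => lift p w) _ p := (hasFDerivAt_const w p).sub
      ((torsion.hasFDerivAt.clm_apply (hasFDerivAt_const w p)).const_smul (1 / 2 : ℝ))
    rw [((h2 p).hasFDerivAt.clm_apply hl).fderiv]
    simp [sub_eq_add_neg, add_comm]
  ext p
  have hsym : IsSymmSndFDerivAt ℝ (h : Pt → ℝ) p :=
    (smooth_contDiff h).contDiffAt.isSymmSndFDerivAt (by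
    rw [minSmoothness_of_isRCLikeNormedField]
    exact WithTop.coe_le_coe.2 (le_top : (2 : ℕ∞) ≤ ⊤))
  have e : torsion (lift p v) w = torsion v w := torsion_lift_left p v w
  have e' : torsion (lift p w) v = -torsion v w := by rw [torsion_lift_left, torsion_skew]
  have e3 : lift p (torsion v w) = torsion v w := by simp [lift, torsion_torsion_right]
  change fderiv ℝ (fun p => fderiv ℝ (h : Pt → ℝ) p (lift p w)) p (lift p v) -
    fderiv ℝ (fun p => fderiv ℝ (h : Pt → ℝ) p (lift p v)) p (lift p w) =
    -fderiv ℝ (h : Pt → ℝ) p (lift p (torsion v w))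
  rw [key, key, e, e', e3, hsym (lift p v) (lift p w), map_neg]
  ring

theorem frameDer_add (v w : Pt) (h : smooth) :
    frameDer (v + w) h = frameDer v h + frameDer w h := by
  ext p
  simp [frameDer_apply, lift, add_sub_add_comm]

theorem frameDer_smul (t : ℝ) (v : Pt) (h : smooth) : frameDer (t • v) h = t • frameDer v h := by
  ext p
  simp [frameDer_apply, lift, mul_sub, mul_left_comm]

/-- The coordinate frame vector. -/
def frameVec (k : Fin 24) : Pt := Pi.single k 1

theorem frameVec_self (k : Fin 24) : frameVec k k = 1 := Pi.single_eq_same _ _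

theorem frameVec_ne {k l : Fin 24} (h : (l : ℕ) ≠ k) : frameVec k l = 0 :=
  Pi.single_eq_of_ne (fun e => h (congrArg Fin.val e)) _

theorem frameVec_xIdx_uIdx (b i) : frameVec (xIdx b) (uIdx i) = 0 :=
  frameVec_ne (by simp; omega)

theorem frameVec_uIdx_xIdx (i b) : frameVec (uIdx i) (xIdx b) = 0 :=
  frameVec_ne (by simp; omega)

theorem frameVec_xIdx (a b) : frameVec (xIdx a) (xIdx b) = if b = a then 1 else 0 := by
  split_ifs with h
  · rw [h, frameVec_self]
  · exact frameVec_ne (by simpa [Fin.ext_iff] using h)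

theorem frameVec_uIdx (i j) : frameVec (uIdx i) (uIdx j) = if j = i then 1 else 0 := by
  split_ifs with h
  · rw [h, frameVec_self]
  · exact frameVec_ne (by simpa [Fin.ext_iff] using h)

theorem torsion_frameVec (a b : Fin 16) : torsion (frameVec (xIdx a)) (frameVec (xIdx b)) =
    ∑ i, (skew i a b : ℝ) • frameVec (uIdx i) := by
  refine Pt.ext_idx (fun i => ?_) fun c => ?_
  · simp [torsion_uIdx, form, frameVec_xIdx, frameVec_uIdx]
  · simp [torsion_xIdx, frameVec_uIdx_xIdx]

theorem torsion_frameVec_uIdx (i : Fin 8) (w : Pt) : torsion (frameVec (uIdx i)) w = 0 :=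
  torsion_zero_of_central (frameVec_uIdx_xIdx i) w

/-- The frame component of a vector field. -/
def comp (Y : Pt → Pt) (hY : ContDiff ℝ (⊤ : ℕ∞) Y) (k : Fin 24) : smooth :=
  ⟨fun p => coframe p (Y p) k, (contDiff_pi.1 (contDiff_coframe hY)) k⟩

/-- The frame components of a symmetry. -/
def symmetryData (Y : Pt → Pt) (hY : Y ∈ symH) : SymmetryData smooth where
  X b := frameDer (frameVec (xIdx b))
  U i := frameDer (frameVec (uIdx i))
  comm_XX a b h := by
    let L : Pt →ₗ[ℝ] smooth :=
      ⟨⟨fun v => frameDer v h, fun v w => frameDer_add v w h⟩, fun t v => frameDer_smul t v h⟩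
    have : ∀ v, frameDer v h = L v := fun _ => rfl
    rw [frameDer_comm, torsion_frameVec, this, map_sum]
    simp only [map_smul]
    rfl
  comm_UX i b h := by
    have := frameDer_comm (frameVec (uIdx i)) (frameVec (xIdx b)) h
    rw [torsion_frameVec_uIdx, ← zero_smul ℝ (0 : Pt), frameDer_smul, zero_smul, neg_zero] at this
    exact sub_eq_zero.1 this
  f i := comp Y hY.1 (uIdx i)
  g a := comp Y hY.1 (xIdx a)
  X_f b i := by
    ext p
    have hc : DifferentiableAt ℝ (fun p => coframe p (Y p)) p :=
      (contDiff_coframe hY.1).differentiable (by simp) p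
    have := (mem_symH_iff.1 hY).2 p (frameVec (xIdx b)) (frameVec_xIdx_uIdx b) i
    have e := congrArg (fun L => L (lift p (frameVec (xIdx b)))) (fderiv_apply (𝕜 := ℝ) hc (uIdx i))
    change fderiv ℝ (fun p => coframe p (Y p) (uIdx i)) p (lift p (frameVec (xIdx b))) =
      (sgn b i : ℝ) * coframe p (Y p) (xIdx (partner b i))
    have e' : form i (frameVec (xIdx b)) (coframe p (Y p)) =
        (sgn b i : ℝ) * coframe p (Y p) (xIdx (partner b i)) := by
      rw [form_eq, Finset.sum_eq_single b]
      · simp [frameVec_self]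
      · intro c _ hc; simp [frameVec_xIdx, hc]
      · simp
    rw [← e', ← this]
    exact e

theorem smooth_eq_zero (h : smooth) (hX : ∀ b, frameDer (frameVec (xIdx b)) h = 0)
    (h0 : (h : Pt → ℝ) 0 = 0) : h = 0 := by
  have hU : ∀ i, frameDer (frameVec (uIdx i)) h = 0 := by
    intro i
    have key : ∃ a b, ∀ k, skew k a b = if k = i then 1 else 0 := by
      revert i; decide +kernel
    obtain ⟨a, b, hab⟩ := key
    have := frameDer_comm (frameVec (xIdx a)) (frameVec (xIdx b)) h
    rw [hX, hX, map_zero, map_zero, sub_zero, torsion_frameVec] at this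
    simpa [hab] using this.symm
  have hd : ∀ p, fderiv ℝ (h : Pt → ℝ) p = 0 := by
    intro p
    ext v
    have e : frameDer (coframe p v) h = 0 := by
      have : coframe p v = ∑ k, coframe p v k • frameVec k := by
        ext k; simp [frameVec, Pi.single_apply]
      let L : Pt →ₗ[ℝ] smooth :=
        ⟨⟨fun v => frameDer v h, fun v w => frameDer_add v w h⟩, fun t v => frameDer_smul t v h⟩
      change L (coframe p v) = 0
      rw [this, map_sum]
      refine Finset.sum_eq_zero fun k _ => ?_
      rw [map_smul]
      have : L (frameVec k) = 0 := by
        induction k using Fin.addCases (m := 8) (n := 16) with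
        | left i => exact hU i
        | right b => exact hX b
      rw [this, smul_zero]
    have := congrArg (fun h : smooth => (h : Pt → ℝ) p) e
    simpa [frameDer_apply, lift_coframe] using this
  ext p
  rw [is_const_of_fderiv_eq_zero (smooth_differentiable h) hd p 0, h0]
  rfl

/-- The coordinate functions of the exponential. -/
def expComp (v : Jet) (r : Fin 78) : smooth :=
  ⟨fun p => pexp p v r, mem_smooth.2 (contDiff_pi.1 (contDiff_pexp_apply v) r)⟩

theorem expComp_zero (v : Jet) (r) : (expComp v r : Pt → ℝ) 0 = v r := by
  change pexp 0 v r = v r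
  rw [pexp_zero]; rfl

theorem frameDer_expComp (v : Jet) (k : Fin 24) {r c : Fin 78} {z : ℤ}
    (h : row k r = [((c : ℕ), z)]) : frameDer (frameVec k) (expComp v r) = (z : ℝ) • expComp v c := by
  ext p
  have hd := (contDiff_pexp_apply v).differentiable (by simp) p
  have e := congrArg (fun L => L (lift p (frameVec k))) (fderiv_apply (𝕜 := ℝ) hd r)
  have e2 : pencil (frameVec k) = frameOp k := by
    simp [pencil_apply, frameVec, Pi.single_apply]
  change fderiv ℝ (fun p => pexp p v r) p (lift p (frameVec k)) = (z : ℝ) * pexp p v c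
  refine e.trans ?_
  rw [ContinuousLinearMap.comp_apply, fderiv_pexp_apply, fderiv_pexp_lift, e2, mul_apply_eq_comp]
  change frameOp k (pexp p v) r = _
  rw [frameOp_apply, h, eval_cons, eval_nil, Fin.ofNat_val_eq_self, add_zero]

/-- The pairs of central indices labelling the infinitesimal rotations. -/
def rotPairs : List (Fin 8 × Fin 8) :=
  (List.finRange 8).flatMap fun i => ((List.finRange 8).filter (i < ·)).map fun j => (i, j)

def rotIdx (i j : Fin 8) : Fin 78 := Fin.ofNat 78 (24 + rotPairs.idxOf (i, j))

/-- The jet at the origin of a symmetry. -/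
def SymmetryData.jet {C : Type*} [AddCommGroup C] [Module ℝ C] (S : SymmetryData C)
    (ev : C →ₗ[ℝ] ℝ) : Jet := fun c =>
  if h : (c : ℕ) < 8 then ev (S.f ⟨c, h⟩)
  else if h : (c : ℕ) - 8 < 16 then ev (S.g ⟨c - 8, h⟩)
  else if (c : ℕ) < 52 then
    (1 / 2 : ℝ) * ev (S.U (rotPairs.getD (c - 24) (0, 0)).1
      (S.f (dual (rotPairs.getD (c - 24) (0, 0)).2)))
  else if (c : ℕ) = 52 then (1 / 2 : ℝ) * ev S.φ
  else if (c : ℕ) = 53 then ev (S.X 0 (S.g 8))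
  else if h : (c : ℕ) - 54 < 16 then (1 / 2 : ℝ) * ev (S.X ⟨c - 54, h⟩ S.φ)
  else (1 / 4 : ℝ) * ev (S.U (Fin.ofNat 8 (c - 70)) S.φ)

theorem rotIdx_spec : ∀ i j : Fin 8, i < j →
    row (uIdx i) (jetIdx (uIdx (dual j))) = [((rotIdx i j : ℕ), 2)] ∧
    24 ≤ (rotIdx i j : ℕ) ∧ (rotIdx i j : ℕ) < 52 ∧
    rotPairs.getD ((rotIdx i j : ℕ) - 24) (0, 0) = (i, j) := by
  decide +kernel

theorem eq_symField_of_mem {Y : Pt → Pt} (hY : Y ∈ symH) : ∃ v, Y = symField v := by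
  let ev : smooth →ₗ[ℝ] ℝ := (LinearMap.proj (0 : Pt)).comp smooth.subtype
  have ev_exp : ∀ v r, ev (expComp v r) = v r := expComp_zero
  let S := symmetryData Y hY
  let v := S.jet ev
  refine ⟨v, ?_⟩
  have hd : ∀ p, coframe p (Y p - symField v p) = coframe p (Y p) - jetRes (pexp p v) := fun p => by
    rw [← coframe_symField]; simp [coframe]; module
  have hZ : (Y - symField v) ∈ symH := by
    have h1 := mem_symH_iff.1 hY
    have h2 := mem_symH_iff.1 (symField_mem v)
    refine mem_symH_iff.2 ⟨h1.1.sub h2.1, fun p w hw i => ?_⟩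
    have e1 := h1.2 p w hw i
    have e2 := h2.2 p w hw i
    simp only [coframe_symField, Pi.sub_apply, hd] at e1 e2 ⊢
    have hY' := (contDiff_coframe h1.1).differentiable (by simp) p
    have hv' := (contDiff_coframe h2.1).differentiable (by simp) p
    simp only [coframe_symField] at hv'
    rw [fderiv_fun_sub hY' hv', sub_apply, Pi.sub_apply, e1, e2, ← torsion_uIdx, ← torsion_uIdx,
      ← torsion_uIdx, map_sub]
    rfl
  let T := symmetryData _ hZ
  have hf : ∀ i, T.f i = S.f i - expComp v (jetIdx (uIdx i)) := fun i => by
    ext p; exact congrFun (hd p) (uIdx i)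
  have hg : ∀ a, T.g a = S.g a - expComp v (jetIdx (xIdx a)) := fun a => by
    ext p; exact congrFun (hd p) (xIdx a)
  have hU : ∀ i, T.U i = frameDer (frameVec (uIdx i)) := fun _ => rfl
  have hX : ∀ b, T.X b = frameDer (frameVec (xIdx b)) := fun _ => rfl
  have hφ : T.φ = S.φ - (2 : ℝ) • expComp v 52 := by
    rw [SymmetryData.φ, hf, map_sub, hU, frameDer_expComp v (uIdx 3) (c := 52) (z := 2) (by decide)]
    norm_num; rfl
  have h0 : ∀ i, T.f i = 0 := by
    refine T.f_eq_zero ev (fun h => smooth_eq_zero h) ?_ ?_ ?_ ?_ ?_ ?_ ?_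
    · intro i
      rw [hf, map_sub, ev_exp, sub_eq_zero]
      simp [v, SymmetryData.jet]
    · intro a
      rw [hg, map_sub, ev_exp, sub_eq_zero]
      simp [v, SymmetryData.jet]
    · intro i j hij
      obtain ⟨h1, h2, h3, h4⟩ := rotIdx_spec i j hij
      rw [hf, map_sub, hU, frameDer_expComp v _ h1, map_sub, map_smul, ev_exp]
      have : v (rotIdx i j) = (1 / 2 : ℝ) * ev (S.U i (S.f (dual j))) := by
        simp only [v, SymmetryData.jet]
        rw [dif_neg (by omega), dif_neg (by omega), if_pos h3, h4]
      rw [this]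
      simp only [smul_eq_mul, Int.cast_ofNat]
      change ev (S.U i (S.f (dual j))) - _ = 0
      ring
    · rw [hφ, map_sub, map_smul, ev_exp]
      have : v 52 = (1 / 2 : ℝ) * ev S.φ := rfl
      rw [this]; simp
    · rw [hg, map_sub, hX, frameDer_expComp v (xIdx 0) (c := 53) (z := 1) (by decide), map_sub,
        map_smul, ev_exp]
      have : v 53 = ev (S.X 0 (S.g 8)) := rfl
      rw [this, Int.cast_one, one_smul]; exact sub_self _
    · intro a
      have hr : ∀ a : Fin 16, row (xIdx a) 52 = [(((Fin.ofNat 78 (54 + a) : Fin 78) : ℕ), 1)] := by decide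
      rw [hφ, map_sub, map_smul, hX, frameDer_expComp v (xIdx a) (hr a), map_sub, map_smul,
        map_smul, ev_exp]
      have : ∀ a : Fin 16, v (Fin.ofNat 78 (54 + a)) = (1 / 2 : ℝ) * ev (S.X a S.φ) := by
        intro a
        have e : ((Fin.ofNat 78 (54 + a) : Fin 78) : ℕ) = 54 + a := by
          rw [Fin.val_ofNat]; omega
        simp only [v, SymmetryData.jet, e]
        rw [dif_neg (by omega), dif_neg (by omega), if_neg (by omega), if_neg (by omega),
          if_neg (by omega), dif_pos (by omega)]
        simp
      rw [this]
      change ev (S.X a S.φ) - _ = 0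
      simp
    · intro a
      have hr : ∀ a : Fin 8, row (uIdx a) 52 = [(((Fin.ofNat 78 (70 + a) : Fin 78) : ℕ), 2)] := by decide
      rw [hφ, map_sub, map_smul, hU, frameDer_expComp v (uIdx a) (hr a), map_sub, map_smul,
        map_smul, ev_exp]
      have : v (Fin.ofNat 78 (70 + a)) = (1 / 4 : ℝ) * ev (S.U a S.φ) := by
        have e : ((Fin.ofNat 78 (70 + a) : Fin 78) : ℕ) = 70 + a := by
          rw [Fin.val_ofNat]; omega
        simp only [v, SymmetryData.jet, e]
        rw [dif_neg (by omega), dif_neg (by omega), if_neg (by omega), if_neg (by omega),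
          if_neg (by omega), dif_neg (by omega)]
        simp
      rw [this]
      change ev (S.U a S.φ) - _ = 0
      simp only [smul_eq_mul, Int.cast_ofNat]
      ring
  have h1 : ∀ a, T.g a = 0 := by
    intro a
    have key : ∃ b i, sgn b i ≠ 0 ∧ partner b i = a := by
      revert a; decide +kernel
    obtain ⟨b, i, hs, rfl⟩ := key
    rw [T.g_eq hs rfl, h0, map_zero, smul_zero]
  refine eq_of_coframe_eq fun p => sub_eq_zero.1 ?_
  rw [coframe_symField, ← hd]
  refine Pt.ext_idx (fun i => ?_) fun a => ?_
  · exact congrFun (congrArg Subtype.val (h0 i)) p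
  · exact congrFun (congrArg Subtype.val (h1 a)) p

theorem jet_pivot : ∀ c : Fin 78, 8 ≤ (c : ℕ) → ∃ k : Fin 24,
    ∃ r ∈ ([0, 1, 2, 3, 4, 5, 6, 7, 16, 52] : List (Fin 78)), (c < 24 ∨ r < c) ∧
    ∃ z ∈ ([1, -1, 2] : List ℤ), row k r = [((c : ℕ), z)] := by
  decide +kernel

theorem exists_frameOp_ne_zero {v : Jet} {c : Fin 78} (hc : 8 ≤ (c : ℕ)) (h : v c ≠ 0) :
    ∃ k r, (c < 24 ∨ r < c) ∧ frameOp k v r ≠ 0 := by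
  obtain ⟨k, r, -, hr, z, hz, e⟩ := jet_pivot c hc
  refine ⟨k, r, hr, ?_⟩
  rw [frameOp_apply, e, eval_cons, eval_nil, Fin.ofNat_val_eq_self, add_zero]
  refine mul_ne_zero (fun h0 => ?_) h
  rw [Int.cast_eq_zero] at h0
  subst h0
  simp at hz

theorem pencil_frameVec (k : Fin 24) : pencil (frameVec k) = frameOp k := by
  simp [pencil_apply, frameVec, Pi.single_apply]

theorem vfBracket_zero (X : Pt → Pt) : vfBracket X 0 = 0 := by
  ext1 p; simp [vfBracket]

theorem symField_injective : Function.Injective symField := by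
  rw [← LinearMap.ker_eq_bot, LinearMap.ker_eq_bot']
  have hK : ∀ v, symField v = 0 → ∀ k, symField (frameOp k v) = 0 := by
    intro v hv k
    rw [← pencil_frameVec, ← vfBracket_rightField, hv, vfBracket_zero]
  have hr : ∀ v, symField v = 0 → jetRes v = 0 := by
    intro v hv
    have := coframe_symField v 0
    rw [hv, pexp_zero] at this
    simpa [coframe] using this.symm
  have key : ∀ n : ℕ, ∀ c : Fin 78, (c : ℕ) = n → ∀ v, symField v = 0 → v c = 0 := by
    intro n
    induction n using Nat.strong_induction_on with
    | _ n ih =>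
      rintro c rfl v hv
      by_cases hc : (c : ℕ) < 24
      · exact congrFun (hr v hv) ⟨c, hc⟩
      · by_contra h
        obtain ⟨k, r, hrc, hne⟩ := exists_frameOp_ne_zero (by omega) h
        refine hne (ih r ?_ r rfl _ (hK v hv k))
        rcases hrc with h' | h'
        · exact absurd h' hc
        · exact h'
  exact fun v hv => funext fun c => key c c rfl v hv

/-- The basis jets. -/
def jetVec (c : Fin 78) : Jet := Pi.single c 1

/-- The matrix entry `(r, c)` of the `k`-th frame operator. -/
def entry (k r : ℕ) (c : Fin 78) : ℤ :=
  ((row k r).map fun e => if Fin.ofNat 78 e.1 = c then e.2 else 0).sum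

theorem frameOp_jetVec (k : Fin 24) (c r : Fin 78) : frameOp k (jetVec c) r = entry k r c := by
  rw [frameOp_apply, eval, entry, Int.cast_list_sum, List.map_map]
  congr 1
  refine List.map_congr_left fun e _ => ?_
  simp [jetVec, Pi.single_apply]

/-- The action of a jet of degree two on the centre. -/
def rotMatrix (c : Fin 78) : Matrix (Fin 8) (Fin 8) ℤ := .of fun r m => entry m r c

/-- The central vectors. -/
def centralIncl : (Fin 8 → ℝ) →ₗ[ℝ] Pt where
  toFun x := Fin.addCases (m := 8) (n := 16) (motive := fun _ => ℝ) x fun _ => 0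
  map_add' x y := Pt.ext_idx (fun i => by simp) fun b => by simp
  map_smul' t x := Pt.ext_idx (fun i => by simp) fun b => by simp

theorem centralIncl_apply (x) : centralIncl x =
    fun k => Fin.addCases (m := 8) (n := 16) (motive := fun _ => ℝ) x (fun _ => 0) k := rfl

theorem centralIncl_uIdx (x i) : centralIncl x (uIdx i) = x i := by
  rw [centralIncl_apply]; exact Fin.addCases_left i

theorem centralIncl_xIdx (x b) : centralIncl x (xIdx b) = 0 := by
  rw [centralIncl_apply]; exact Fin.addCases_right b

theorem jetIncl_of_not_lt (z : Pt) {c : Fin 78} (h : ¬ (c : ℕ) < 24) : jetIncl z c = 0 := dif_neg h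

theorem pencil_centralIncl (x : Fin 8 → ℝ) {c : Fin 78} (hc : deg c = 2) :
    pencil (centralIncl x) (jetVec c) =
      jetIncl (centralIncl (((rotMatrix c).map fun z : ℤ => (z : ℝ)).mulVec x)) := by
  have h : pencil (centralIncl x) (jetVec c) =
      ∑ m, x m • frameOp (uIdx m) (jetVec c) := by
    rw [pencil_split]
    simp [centralIncl_uIdx, centralIncl_xIdx, _root_.sum_apply]
  have hb : Below 3 (jetVec c) := by
    intro d hd
    refine Pi.single_eq_of_ne (fun e => ?_) _
    rw [e] at hd; omega
  rw [h]
  ext r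
  by_cases hr : (r : ℕ) < 8
  · obtain ⟨i, rfl⟩ : ∃ i : Fin 8, r = jetIdx (uIdx i) := ⟨⟨r, hr⟩, rfl⟩
    rw [jetIncl_jetIdx, centralIncl_uIdx]
    simp only [Finset.sum_apply, Pi.smul_apply, frameOp_jetVec, smul_eq_mul, Matrix.mulVec,
      dotProduct, Matrix.map_apply, rotMatrix, Matrix.of_apply]
    exact Finset.sum_congr rfl fun m _ => mul_comm _ _
  · have h1 : 1 ≤ deg r := by
      have : ∀ c : Fin 78, ¬ (c : ℕ) < 8 → 1 ≤ deg c := by decide +kernel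
      exact this r hr
    have h2 : (∑ m, x m • frameOp (uIdx m) (jetVec c)) r = 0 := by
      rw [Finset.sum_apply]
      refine Finset.sum_eq_zero fun m _ => ?_
      rw [Pi.smul_apply, hb.frameOp (uIdx m) r (by rw [wt_uIdx]; exact h1), smul_zero]
    rw [h2]
    by_cases hr' : (r : ℕ) < 24
    · have h4 : r = jetIdx (xIdx ⟨r - 8, by omega⟩) := by ext; simp; omega
      rw [h4, jetIncl_jetIdx, centralIncl_xIdx]
    · exact (jetIncl_of_not_lt _ hr').symm

/-- Words in the degree two jets mapping a central basis vector to the first one and killing the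
others. -/
def wordTo (i : Fin 8) : List (Fin 78) :=
  [[30, 36, 29], [30, 36], [30, 41], [30, 45], [30, 48], [30, 50], [30, 51], [36, 51]].getD i []

/-- Words in the degree two jets mapping the first central basis vector to a given one. -/
def wordFrom (i : Fin 8) : List (Fin 78) :=
  [[], [29], [28], [26], [27], [25], [24], [24, 29]].getD i []

theorem deg_wordTo : ∀ i, ∀ c ∈ wordTo i, deg c = 2 := by decide +kernel

theorem deg_wordFrom : ∀ i, ∀ c ∈ wordFrom i, deg c = 2 := by decide +kernel

theorem wordTo_spec : ∀ i, ∃ z ∈ ([4, 8] : List ℤ),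
    ((wordTo i).map rotMatrix).prod = Matrix.single 0 i z := by
  decide +kernel

theorem wordFrom_spec : ∀ i, ∃ z ∈ ([1, 2, 4] : List ℤ),
    ∀ r, ((wordFrom i).map rotMatrix).prod r 0 = if r = i then z else 0 := by
  decide +kernel

theorem frameOp_three : frameOp 3 (jetVec 73) = (2 : ℝ) • gradingJet := by
  have : ∀ r : Fin 78, entry 3 r 73 = 2 * if (r : ℕ) ∈ [30, 35, 39, 52] then 1 else 0 := by
    decide +kernel
  ext r
  rw [frameOp_jetVec]
  refine (congrArg (fun z : ℤ => (z : ℝ)) (this r)).trans ?_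
  rw [Int.cast_mul]; rfl

/-- Certificates expressing the degree two jets through frame operators: `(N, l)` for `c` means
that `N` times the basis jet `c` is the combination of the `frameOp k (jetVec d)` in `l`. -/
def generation (c : Fin 78) : ℤ × List ((Fin 24 × Fin 78) × ℤ) :=
  [(2, [((6, 70), 1)]), (2, [((5, 70), 1)]), (2, [((3, 70), 1)]), (2, [((4, 70), 1)]),
    (2, [((2, 70), 1)]), (2, [((1, 70), 1)]), (2, [((11, 57), 1), ((15, 61), -1)]),
    (2, [((5, 71), 1)]), (2, [((3, 71), 1)]), (2, [((4, 71), 1)]), (2, [((2, 71), 1)]),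
    (2, [((13, 59), 1), ((15, 61), -1)]), (2, [((0, 71), 1)]), (2, [((3, 72), 1)]),
    (2, [((4, 72), 1)]), (2, [((14, 60), 1), ((15, 61), -1)]), (2, [((1, 72), 1)]),
    (2, [((0, 72), 1)]), (3, [((3, 74), -2), ((8, 62), 1)]), (2, [((2, 73), 1)]),
    (2, [((1, 73), 1)]), (2, [((0, 73), 1)]), (2, [((2, 74), 1)]), (2, [((1, 74), 1)]),
    (2, [((0, 74), 1)]), (2, [((1, 75), 1)]), (2, [((0, 75), 1)]), (2, [((0, 76), 1)]),
    (1, [((15, 61), 1)]), (6, [((8, 62), -2), ((3, 74), 1)])].getD (c - 24) (0, [])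

theorem generation_spec : ∀ c : Fin 78, deg c = 2 → (generation c).1 ≠ 0 ∧
    ∀ r : Fin 78, (if r = c then (generation c).1 else 0) =
      ((generation c).2.map fun e => e.2 * entry e.1.1 r e.1.2).sum := by
  decide +kernel

theorem smul_jetVec (c : Fin 78) (h : deg c = 2) : ((generation c).1 : ℝ) • jetVec c =
    ((generation c).2.map fun e => (e.2 : ℝ) • frameOp e.1.1 (jetVec e.1.2)).sum := by
  ext r
  have h1 := congrArg (fun z : ℤ => (z : ℝ)) ((generation_spec c h).2 r)
  have h2 : ∀ l : List ((Fin 24 × Fin 78) × ℤ),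
      (l.map fun e => (e.2 : ℝ) • frameOp e.1.1 (jetVec e.1.2)).sum r =
        ((l.map fun e => e.2 * entry e.1.1 r e.1.2).sum : ℤ) := by
    intro l
    induction l with
    | nil => simp
    | cons e l ih => simp [ih, frameOp_jetVec]
  rw [h2, ← h1]
  simp [jetVec, Pi.single_apply]

theorem eq_sum_jetVec (v : Jet) : v = ∑ c, v c • jetVec c := by
  ext r; simp [jetVec, Pi.single_apply, Finset.sum_apply]

theorem eq_jetIncl_centralIncl {v : Jet} (h : Below 1 v) :
    v = jetIncl (centralIncl fun i => v (jetIdx (uIdx i))) := by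
  have hd : ∀ c : Fin 78, 8 ≤ (c : ℕ) → 1 ≤ deg c := by decide +kernel
  ext r
  by_cases hr : (r : ℕ) < 24
  · obtain ⟨k, rfl⟩ : ∃ k : Fin 24, r = jetIdx k := ⟨⟨r, hr⟩, rfl⟩
    rw [jetIncl_jetIdx]
    induction k using Fin.addCases (m := 8) (n := 16) with
    | left i => rw [centralIncl_uIdx]
    | right b => rw [centralIncl_xIdx]; exact h _ (hd _ (by simp))
  · rw [jetIncl_of_not_lt _ hr]
    exact h _ (hd _ (by omega))

section Ideal

variable {J : Submodule ℝ Jet}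

theorem exists_mem_below_one (hF : ∀ z, ∀ v ∈ J, pencil z v ∈ J) (m : ℕ) :
    ∀ v ∈ J, v ≠ 0 → Below (m + 1) v → ∃ w ∈ J, w ≠ 0 ∧ Below 1 w := by
  induction m with
  | zero => exact fun v hv h0 hb => ⟨v, hv, h0, hb⟩
  | succ m ih =>
    intro v hv h0 hb
    by_cases h1 : Below 1 v
    · exact ⟨v, hv, h0, h1⟩
    have hd : ∀ c : Fin 78, 1 ≤ deg c → 8 ≤ (c : ℕ) := by decide +kernel
    obtain ⟨c, hc, hne⟩ : ∃ c, 1 ≤ deg c ∧ v c ≠ 0 := by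
      simpa only [Below, not_forall, exists_prop] using h1
    obtain ⟨k, r, -, hr⟩ := exists_frameOp_ne_zero (hd c hc) hne
    have hw : 1 ≤ wt k := by unfold wt; split_ifs <;> norm_num
    refine ih (frameOp k v) ?_ (fun e => hr (by rw [e]; rfl)) fun d hdd => hb.frameOp k d (by omega)
    rw [← pencil_frameVec]
    exact hF _ v hv

theorem mulVec_word_mem (hP : ∀ z, jetIncl z ∈ J → ∀ v, pencil z v ∈ J) (l : List (Fin 78))
    (hl : ∀ c ∈ l, deg c = 2) (x : Fin 8 → ℝ) (hx : jetIncl (centralIncl x) ∈ J) :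
    jetIncl (centralIncl (((l.map rotMatrix).prod.map fun z : ℤ => (z : ℝ)).mulVec x)) ∈ J := by
  induction l with
  | nil => simpa [Matrix.map_one] using hx
  | cons c l ih =>
    have h := hP _ (ih fun d hd => hl d (List.mem_cons_of_mem _ hd)) (jetVec c)
    rw [pencil_centralIncl _ (hl c List.mem_cons_self), Matrix.mulVec_mulVec] at h
    rw [List.map_cons, List.prod_cons]
    exact (Matrix.map_mul (f := Int.castRingHom ℝ) (L := rotMatrix c)
      (M := (l.map rotMatrix).prod)) ▸ h

theorem single_mem (hP : ∀ z, jetIncl z ∈ J → ∀ v, pencil z v ∈ J) {x : Fin 8 → ℝ} (h0 : x ≠ 0)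
    (hx : jetIncl (centralIncl x) ∈ J) (n : Fin 8) :
    jetIncl (centralIncl (Pi.single n 1)) ∈ J := by
  have hs : ∀ (t : ℝ) (i : Fin 8), t ≠ 0 → jetIncl (centralIncl (t • Pi.single i 1)) ∈ J →
      jetIncl (centralIncl (Pi.single i 1)) ∈ J := by
    intro t i ht h
    rw [map_smul, map_smul] at h
    exact (J.smul_mem_iff ht).1 h
  obtain ⟨i, hi⟩ := Function.ne_iff.1 h0
  obtain ⟨z, hz, hto⟩ := wordTo_spec i
  obtain ⟨y, hy, hfrom⟩ := wordFrom_spec n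
  have hz0 : (z : ℝ) ≠ 0 := by
    rw [Int.cast_ne_zero]; rintro rfl; simp at hz
  have hy0 : (y : ℝ) ≠ 0 := by
    rw [Int.cast_ne_zero]; rintro rfl; simp at hy
  have h1 := mulVec_word_mem hP _ (deg_wordTo i) x hx
  have e1 : (((wordTo i).map rotMatrix).prod.map fun z : ℤ => (z : ℝ)).mulVec x =
      ((z : ℝ) * x i) • Pi.single 0 1 := by
    rw [hto]
    ext r
    by_cases hr : 0 = r <;>
      simp [Matrix.mulVec, dotProduct, Matrix.single_apply, hr]
  rw [e1] at h1
  have h2 := mulVec_word_mem hP _ (deg_wordFrom n) _ (hs _ _ (mul_ne_zero hz0 hi) h1)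
  have e2 : (((wordFrom n).map rotMatrix).prod.map fun z : ℤ => (z : ℝ)).mulVec
      (Pi.single 0 1) = (y : ℝ) • Pi.single n 1 := by
    ext r
    rw [Matrix.mulVec_single_one, Matrix.col_apply, Matrix.map_apply, hfrom]
    simp [Pi.single_apply]
  rw [e2] at h2
  exact hs _ _ hy0 h2

theorem gradingJet_mem (hP : ∀ z, jetIncl z ∈ J → ∀ v, pencil z v ∈ J)
    (h : jetIncl (centralIncl (Pi.single 3 1)) ∈ J) : gradingJet ∈ J := by
  have e : centralIncl (Pi.single 3 1) = frameVec 3 := by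
    refine Pt.ext_idx (fun i => ?_) fun b => ?_
    · rw [centralIncl_uIdx, show (3 : Fin 24) = uIdx 3 from rfl, frameVec_uIdx, Pi.single_apply]
    · rw [centralIncl_xIdx, show (3 : Fin 24) = uIdx 3 from rfl, frameVec_uIdx_xIdx]
  have := hP _ h (jetVec 73)
  rw [e, pencil_frameVec, frameOp_three] at this
  exact (J.smul_mem_iff two_ne_zero).1 this

theorem eq_top_of_degOp_mem (hP : ∀ z, jetIncl z ∈ J → ∀ v, pencil z v ∈ J)
    (hE : ∀ v, degOp v ∈ J) : J = ⊤ := by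
  have h1 : ∀ c, deg c ≠ 2 → jetVec c ∈ J := by
    intro c hc
    have e : degOp (jetVec c) = ((deg c : ℝ) - 2) • jetVec c := by
      ext r
      rw [degOp_apply, Pi.smul_apply, smul_eq_mul, jetVec]
      by_cases h : r = c
      · rw [h]
      · rw [Pi.single_eq_of_ne h, mul_zero, mul_zero]
    have h2 : (deg c : ℝ) - 2 ≠ 0 := sub_ne_zero.2 (by exact_mod_cast hc)
    exact (J.smul_mem_iff h2).1 (e ▸ hE _)
  have hz : ∀ z, jetIncl z ∈ J := by
    intro z
    rw [eq_sum_jetVec (jetIncl z)]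
    refine J.sum_mem fun c _ => ?_
    by_cases hc : deg c = 2
    · rw [below_jetIncl z c hc.ge, zero_smul]; exact J.zero_mem
    · exact J.smul_mem _ (h1 c hc)
  have h2 : ∀ c, jetVec c ∈ J := by
    intro c
    by_cases hc : deg c = 2
    · have hN : ((generation c).1 : ℝ) ≠ 0 := Int.cast_ne_zero.2 (generation_spec c hc).1
      refine (J.smul_mem_iff hN).1 (smul_jetVec c hc ▸ J.list_sum_mem fun x hx => ?_)
      obtain ⟨e, -, rfl⟩ := List.mem_map.1 hx
      refine J.smul_mem _ ?_
      rw [← pencil_frameVec]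
      exact hP _ (hz _) _
    · exact h1 c hc
  refine eq_top_iff.2 fun v _ => ?_
  rw [eq_sum_jetVec v]
  exact J.sum_mem fun c _ => J.smul_mem _ (h2 c)

theorem eq_bot_or_eq_top (hF : ∀ z, ∀ v ∈ J, pencil z v ∈ J)
    (hP : ∀ z, jetIncl z ∈ J → ∀ v, pencil z v ∈ J)
    (hE : gradingJet ∈ J → ∀ v, degOp v ∈ J) : J = ⊥ ∨ J = ⊤ := by
  refine or_iff_not_imp_left.2 fun hJ => eq_top_of_degOp_mem hP (hE (gradingJet_mem hP ?_))
  obtain ⟨v, hv, h0⟩ := J.ne_bot_iff.1 hJ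
  obtain ⟨w, hw, hw0, hb⟩ := exists_mem_below_one hF 4 v hv h0 (below_five v)
  rw [eq_jetIncl_centralIncl hb] at hw
  refine single_mem hP (fun e => hw0 ?_) hw 3
  rw [eq_jetIncl_centralIncl hb, e, map_zero, map_zero]

end Ideal

theorem vfBracket_mem_symH {Y Z : Pt → Pt} (hY : Y ∈ symH) (hZ : Z ∈ symH) :
    vfBracket Y Z ∈ symH := by
  have smooth_vfBracket : ∀ {Y Z : Pt → Pt}, ContDiff ℝ (⊤ : ℕ∞) Y → ContDiff ℝ (⊤ : ℕ∞) Z →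
      ContDiff ℝ (⊤ : ℕ∞) (vfBracket Y Z) := fun hY hZ =>
    ((hZ.fderiv_right (m := (⊤ : ℕ∞)) (by simp)).clm_apply hY).sub
      ((hY.fderiv_right (m := (⊤ : ℕ∞)) (by simp)).clm_apply hZ)
  refine ⟨smooth_vfBracket hY.1 hZ.1, fun X hX p i => ?_⟩
  have hn : minSmoothness ℝ 2 ≤ ((⊤ : ℕ∞) : WithTop ℕ∞) := by
    rw [minSmoothness_of_isRCLikeNormedField]
    exact WithTop.coe_le_coe.2 (le_top : (2 : ℕ∞) ≤ ⊤)
  have jacobi : vfBracket Y (vfBracket Z X) p =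
      vfBracket (vfBracket Y Z) X p + vfBracket Z (vfBracket Y X) p :=
    VectorField.leibniz_identity_lieBracket hn hY.1.contDiffAt hZ.1.contDiffAt
      hX.1.contDiffAt
  have h1 := hY.2 _ ⟨smooth_vfBracket hZ.1 hX.1, hZ.2 X hX⟩ p i
  have h2 := hZ.2 _ ⟨smooth_vfBracket hY.1 hX.1, hY.2 X hX⟩ p i
  rw [lam_eq] at h1 h2 ⊢
  have h3 : ∀ v w : Pt, coframe p (v + w) = coframe p v + coframe p w := by
    intro v w
    simp only [coframe, map_add, smul_add]
    abel
  rw [jacobi, h3, Pi.add_apply, h2, add_zero] at h1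
  exact h1

theorem coe_range_symField : (LinearMap.range symField : Set (Pt → Pt)) = symH := by
  ext Y
  refine ⟨?_, fun hY => ?_⟩
  · rintro ⟨v, rfl⟩
    exact symField_mem v
  · obtain ⟨v, rfl⟩ := eq_symField_of_mem hY
    exact ⟨v, rfl⟩

/-- The infinitesimal symmetries of the rank-16 distribution on `ℝ²⁴` annihilated by
the eight 1-forms of the E_II Pfaffian system form a Lie subalgebra of the Lie algebra
of smooth vector fields which, as an abstract real Lie algebra, is simple of
dimension 78 (the real form E_II of the exceptional Lie algebra 𝔢₆). -/
theorem EII_distribution_symmetries_simple_dim_78 :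
    ∃ W : Submodule ℝ (Pt → Pt),
      -- the symmetries form a linear subspace of the space of vector fields …
      (W : Set (Pt → Pt)) = symH ∧
      -- … closed under the Lie bracket of vector fields, i.e. a Lie subalgebra, …
      (∀ Y ∈ W, ∀ Z ∈ W, vfBracket Y Z ∈ W) ∧
      -- … which, as an abstract real Lie algebra, is simple:
      -- it has no Lie ideals other than 0 and itself, …
      (∀ I : Submodule ℝ (Pt → Pt), I ≤ W →
        (∀ Y ∈ W, ∀ Z ∈ I, vfBracket Y Z ∈ I) → I = ⊥ ∨ I = W) ∧
      -- … it is not abelian, …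
      (¬ ∀ Y ∈ W, ∀ Z ∈ W, vfBracket Y Z = 0) ∧
      -- … and it has dimension 78.
      Module.finrank ℝ ↥W = 78 := by
  have hW : ∀ Y, Y ∈ LinearMap.range symField ↔ Y ∈ symH := fun Y =>
    Set.ext_iff.1 coe_range_symField Y
  refine ⟨LinearMap.range symField, coe_range_symField, fun Y hY Z hZ => ?_, fun I hI h => ?_,
    fun h => ?_, ?_⟩
  · rw [hW] at *
    exact vfBracket_mem_symH hY hZ
  · have hsymm : ∀ Y ∈ LinearMap.range symField, ∀ Z ∈ I, vfBracket Z Y ∈ I := fun Y hY Z hZ => by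
      rw [vfBracket_antisymm]
      exact I.neg_mem (h Y hY Z hZ)
    have hmap : (I.comap symField).map symField = I := by
      rw [Submodule.map_comap_eq, inf_eq_right.2 hI]
    have key : I.comap symField = ⊥ ∨ I.comap symField = ⊤ := by
      refine eq_bot_or_eq_top (fun z v hv => ?_) (fun z hz v => ?_) fun hg v => ?_
      · rw [Submodule.mem_comap, ← vfBracket_rightField, ← symField_jetIncl]
        exact h _ ⟨_, rfl⟩ _ hv
      · rw [Submodule.mem_comap, ← vfBracket_rightField, ← symField_jetIncl]
        exact hsymm _ ⟨_, rfl⟩ _ hz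
      · rw [Submodule.mem_comap, ← vfBracket_dilation, ← symField_gradingJet]
        exact hsymm _ ⟨_, rfl⟩ _ hg
    rw [← hmap]
    rcases key with e | e <;> rw [e]
    · exact Or.inl (Submodule.map_bot _)
    · exact Or.inr (Submodule.map_top _)
  · have h1 := h (symField gradingJet) ⟨_, rfl⟩ (symField (jetVec 0)) ⟨_, rfl⟩
    rw [symField_gradingJet, vfBracket_dilation] at h1
    have h2 := congrFun ((map_eq_zero_iff symField symField_injective).1 h1) 0
    rw [degOp_apply] at h2
    simp [jetVec, deg] at h2
  · rw [LinearMap.finrank_range_of_inj symField_injective, Module.finrank_fin_fun]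
end
end

section
/- The rank-16 distribution H on R^24 annihilated by the eight E_II 1-forms λ^1,…,λ^8 is bracket generating in one step with growth vector (16,24): at every point p of R^24, the tangent space T_p R^24 is spanned by the values at p of smooth sections of H together with the values at p of Lie brackets [X,Y] of smooth sections X,Y of H. -/
noncomputable section
open ComplexConjugate

/-- The inclusion of the `u`-directions `ℝ⁸` into `ℝ²⁴`. -/
def vert : (Fin 8 → ℝ) →ₗ[ℝ] Pt where
  toFun w := ![w 0, w 1, w 2, w 3, w 4, w 5, w 6, w 7, 0, 0, 0, 0, 0, 0, 0, 0, 0, 0, 0, 0, 0, 0, 0, 0]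
  map_add' v w := by ext i; fin_cases i <;> simp
  map_smul' c w := by ext i; fin_cases i <;> simp

/-- The forms `λ^i` at the point `p`, as a linear map. -/
def lamLin (p : Pt) : Pt →ₗ[ℝ] (Fin 8 → ℝ) where
  toFun := lam p
  map_add' v w := by ext i; fin_cases i <;> simp [lam] <;> ring
  map_smul' c w := by ext i; fin_cases i <;> simp [lam] <;> ring

lemma lam_vert (p : Pt) (w : Fin 8 → ℝ) : lam p (vert w) = w := by
  ext i; fin_cases i <;> simp [lam, vert]

/-- The part of `λ^i` that depends linearly on the base point. -/
def lamBilin (w : Pt) : Pt →ₗ[ℝ] (Fin 8 → ℝ) where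
  toFun p := lam p w - lam 0 w
  map_add' v w := by ext i; fin_cases i <;> simp [lam] <;> ring
  map_smul' c w := by ext i; fin_cases i <;> simp [lam] <;> ring

lemma lam_eq_s2 (p w : Pt) : lam p w = lam 0 w + lamBilin w p := by
  simp [lamBilin]

lemma lamBilin_vert (w : Pt) (c : Fin 8 → ℝ) : lamBilin w (vert c) = 0 := by
  ext i; fin_cases i <;> simp [lamBilin, lam, vert]

lemma lamBilin_swap (v w : Pt) : lamBilin v w = -lamBilin w v := by
  ext i; fin_cases i <;> simp [lamBilin, lam] <;> ring

/-- The horizontal vector field obtained by projecting the constant field `w` to `H`. -/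
def horiz (w : Pt) : Pt → Pt := fun p => w - vert (lam p w)

lemma horiz_eq (w : Pt) : horiz w = fun p =>
    (w - vert (lam 0 w)) - (vert ∘ₗ lamBilin w).toContinuousLinearMap p := by
  funext q
  simp only [horiz, lam_eq_s2 q w, map_add, LinearMap.coe_toContinuousLinearMap',
    LinearMap.comp_apply]
  abel

lemma hasFDerivAt_horiz (w p : Pt) :
    HasFDerivAt (horiz w) (-(vert ∘ₗ lamBilin w).toContinuousLinearMap) p := by
  rw [horiz_eq]
  exact (ContinuousLinearMap.hasFDerivAt _).const_sub _

lemma lam_sub_vert (p w : Pt) : lam p (w - vert (lam p w)) = 0 := by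
  change lamLin p (w - vert (lam p w)) = 0
  rw [map_sub]
  change lam p w - lam p (vert (lam p w)) = 0
  rw [lam_vert, sub_self]

lemma isSectionH_horiz (w : Pt) : IsSectionH (horiz w) := by
  refine ⟨?_, fun p i => congrFun (lam_sub_vert p w) i⟩
  rw [horiz_eq]
  exact contDiff_const.sub (ContinuousLinearMap.contDiff _)

lemma vfBracket_horiz (v w p : Pt) :
    vfBracket (horiz v) (horiz w) p = (-2 : ℝ) • vert (lamBilin w v) := by
  simp only [vfBracket, (hasFDerivAt_horiz _ p).fderiv, neg_apply,
    LinearMap.coe_toContinuousLinearMap', LinearMap.comp_apply, horiz, map_sub, lamBilin_vert,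
    lamBilin_swap v w, map_neg, map_zero]
  module

lemma setOf_section_values (p : Pt) :
    {x : Pt | ∃ X : Pt → Pt, IsSectionH X ∧ X p = x} = LinearMap.ker (lamLin p) := by
  ext x
  constructor
  · rintro ⟨X, hX, rfl⟩
    exact funext (hX.2 p)
  · intro hx
    have hx : lam p x = 0 := hx
    exact ⟨horiz x, isSectionH_horiz x, by simp [horiz, hx]⟩

lemma finrank_ker_lamLin (p : Pt) : Module.finrank ℝ (LinearMap.ker (lamLin p)) = 16 := by
  have hs : LinearMap.range (lamLin p) = ⊤ :=
    LinearMap.range_eq_top.2 fun w => ⟨vert w, lam_vert p w⟩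
  have h := (lamLin p).finrank_range_add_finrank_ker
  rw [hs, finrank_top] at h
  simp only [Module.finrank_fin_fun] at h
  omega

lemma exists_lamBilin_eq_single (i : Fin 8) :
    ∃ v w : Pt, (-2 : ℝ) • lamBilin w v = Pi.single i 1 := by
  have key (a b : Fin 24) (c : ℝ)
      (h : (-2 : ℝ) • lamBilin (Pi.single b 1) (Pi.single a c) = Pi.single i 1) :
      ∃ v w : Pt, (-2 : ℝ) • lamBilin w v = Pi.single i 1 := ⟨_, _, h⟩
  fin_cases i
  · refine key 8 19 (-1) ?_
    ext j; fin_cases j <;> simp [lamBilin, lam]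
  · refine key 8 21 (-1) ?_
    ext j; fin_cases j <;> simp [lamBilin, lam]
  · refine key 8 14 (-1) ?_
    ext j; fin_cases j <;> simp [lamBilin, lam]
  · refine key 8 15 (-1) ?_
    ext j; fin_cases j <;> simp [lamBilin, lam]
  · refine key 8 23 1 ?_
    ext j; fin_cases j <;> simp [lamBilin, lam]
  · refine key 9 15 (-1) ?_
    ext j; fin_cases j <;> simp [lamBilin, lam]
  · refine key 10 23 (-1) ?_
    ext j; fin_cases j <;> simp [lamBilin, lam]
  · refine key 12 23 (-1) ?_
    ext j; fin_cases j <;> simp [lamBilin, lam]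

/-- The rank-16 distribution on `ℝ²⁴` annihilated by the eight 1-forms of the
E_II Pfaffian system is bracket generating in one step, with growth vector `(16, 24)`. -/
theorem EII_distribution_bracket_generating :
    ∀ p : Pt,
      -- the values at `p` of smooth sections of `H` span a 16-dimensional subspace …
      Module.finrank ℝ
        ↥(Submodule.span ℝ {x : Pt | ∃ X : Pt → Pt, IsSectionH X ∧ X p = x}) = 16 ∧
      -- … and together with values at `p` of brackets of sections they span all of `T_p ℝ²⁴`.
      Submodule.span ℝ
        ({x : Pt | ∃ X : Pt → Pt, IsSectionH X ∧ X p = x} ∪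
          {x : Pt | ∃ X Y : Pt → Pt, IsSectionH X ∧ IsSectionH Y ∧ vfBracket X Y p = x}) = ⊤ := by
  intro p
  constructor
  · rw [setOf_section_values, Submodule.span_eq]
    exact finrank_ker_lamLin p
  · rw [eq_top_iff]
    intro x _
    set S := Submodule.span ℝ
        ({x : Pt | ∃ X : Pt → Pt, IsSectionH X ∧ X p = x} ∪
          {x : Pt | ∃ X Y : Pt → Pt, IsSectionH X ∧ IsSectionH Y ∧ vfBracket X Y p = x})
    have hvert (c : Fin 8 → ℝ) : vert c ∈ S := by
      rw [pi_eq_sum_univ' c, map_sum]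
      refine Submodule.sum_mem _ fun i _ => ?_
      rw [map_smul]
      refine Submodule.smul_mem _ _ (Submodule.subset_span (Or.inr ?_))
      obtain ⟨v, w, h⟩ := exists_lamBilin_eq_single i
      refine ⟨horiz v, horiz w, isSectionH_horiz v, isSectionH_horiz w, ?_⟩
      rw [vfBracket_horiz, ← map_smul, h]
    have hx : horiz x p ∈ S :=
      Submodule.subset_span (Or.inl ⟨horiz x, isSectionH_horiz x, rfl⟩)
    simpa [horiz] using S.add_mem hx (hvert (lam p x))
end
end

section
/- The bilinear bracket on the 24-dimensional real vector space n_{E_II} with basis X_1,…,X_24 defined by the E_II structure equations satisfies the Jacobi identity and makes n_{E_II} = n_{−2} ⊕ n_{−1} a 2-step nilpotent graded Lie algebra: n_{−2} = span(X_1,…,X_8) is central, [n_{−1}, n_{−1}] = n_{−2} (so the algebra is fundamental, i.e. generated by n_{−1} = span(X_9,…,X_24)), and [n_{E_II}, [n_{E_II}, n_{E_II}]] = 0. -/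
noncomputable section
open ComplexConjugate

/-- The bracket of the 24-dimensional 2-step nilpotent Lie algebra `n_{E_II}`, in the
basis `X_1, …, X_24` (indexed here by `0, …, 23`): for each term `ε·λ^B∧λ^D` in the E_II
structure equations one has `[X_B, X_D] = -ε·X_A`, and `X_1, …, X_8` are central. -/
def br (v w : Pt) : Pt := fun k =>
  if h : (k : ℕ) < 8 then
    (![-((v 8 * w 19 - v 19 * w 8) + (v 9 * w 18 - v 18 * w 9)
        + (v 10 * w 17 - v 17 * w 10) + (v 11 * w 16 - v 16 * w 11)),
       -((v 8 * w 21 - v 21 * w 8) + (v 9 * w 20 - v 20 * w 9)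
        + (v 12 * w 17 - v 17 * w 12) + (v 13 * w 16 - v 16 * w 13)),
       -((v 8 * w 14 - v 14 * w 8) - (v 10 * w 12 - v 12 * w 10)
        + (v 16 * w 22 - v 22 * w 16) - (v 18 * w 20 - v 20 * w 18)),
       -((v 8 * w 15 - v 15 * w 8) + (v 9 * w 14 - v 14 * w 9)
        + (v 10 * w 13 - v 13 * w 10) + (v 11 * w 12 - v 12 * w 11)
        + (v 16 * w 23 - v 23 * w 16) + (v 17 * w 22 - v 22 * w 17)
        + (v 18 * w 21 - v 21 * w 18) + (v 19 * w 20 - v 20 * w 19)),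
       -(-(v 8 * w 23 - v 23 * w 8) + (v 9 * w 22 - v 22 * w 9)
        + (v 10 * w 21 - v 21 * w 10) - (v 11 * w 20 - v 20 * w 11)
        - (v 12 * w 19 - v 19 * w 12) + (v 13 * w 18 - v 18 * w 13)
        + (v 14 * w 17 - v 17 * w 14) - (v 15 * w 16 - v 16 * w 15)),
       -((v 9 * w 15 - v 15 * w 9) - (v 11 * w 13 - v 13 * w 11)
        + (v 17 * w 23 - v 23 * w 17) - (v 19 * w 21 - v 21 * w 19)),
       -((v 10 * w 23 - v 23 * w 10) + (v 11 * w 22 - v 22 * w 11)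
        + (v 14 * w 19 - v 19 * w 14) + (v 15 * w 18 - v 18 * w 15)),
       -((v 12 * w 23 - v 23 * w 12) + (v 13 * w 22 - v 22 * w 13)
        + (v 14 * w 21 - v 21 * w 14) + (v 15 * w 20 - v 20 * w 15))] : Fin 8 → ℝ) ⟨k, h⟩
  else 0
/-- The stratum `n_{-2} = span (X_1, …, X_8)`. -/
def Nm2 : Submodule ℝ Pt where
  carrier := {v | ∀ k : Fin 24, 8 ≤ (k : ℕ) → v k = 0}
  add_mem' := by
    intro a b ha hb
    simp only [Set.mem_setOf_eq] at ha hb ⊢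
    intro k hk
    simp [Pi.add_apply, ha k hk, hb k hk]
  zero_mem' := by intro k _; rfl
  smul_mem' := by
    intro c v hv
    simp only [Set.mem_setOf_eq] at hv ⊢
    intro k hk
    simp [Pi.smul_apply, hv k hk]

/-- The stratum `n_{-1} = span (X_9, …, X_24)`. -/
def Nm1 : Submodule ℝ Pt where
  carrier := {v | ∀ k : Fin 24, (k : ℕ) < 8 → v k = 0}
  add_mem' := by
    intro a b ha hb
    simp only [Set.mem_setOf_eq] at ha hb ⊢
    intro k hk
    simp [Pi.add_apply, ha k hk, hb k hk]
  zero_mem' := by intro k _; rfl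
  smul_mem' := by
    intro c v hv
    simp only [Set.mem_setOf_eq] at hv ⊢
    intro k hk
    simp [Pi.smul_apply, hv k hk]

theorem br_apply_of_le (v w : Pt) (k : Fin 24) (hk : 8 ≤ (k : ℕ)) : br v w k = 0 := by
  simp [br, Nat.not_lt.mpr hk]

theorem br_mem_Nm2 (v w : Pt) : br v w ∈ Nm2 := br_apply_of_le v w

theorem br_add_smul_left (a : ℝ) (v v' w : Pt) : br (a • v + v') w = a • br v w + br v' w := by
  ext k
  fin_cases k <;> simp [br] <;> ring

theorem br_antisymm (v w : Pt) : br v w = -br w v := by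
  ext k
  fin_cases k <;> simp [br] <;> ring

theorem br_add_smul_right (a : ℝ) (v w w' : Pt) :
    br v (a • w + w') = a • br v w + br v w' := by
  rw [br_antisymm, br_add_smul_left, br_antisymm w, br_antisymm w']
  module

theorem br_eq_zero_of_mem_Nm2 {v : Pt} (hv : v ∈ Nm2) (w : Pt) : br v w = 0 := by
  have h (k : Fin 24) (hk : 8 ≤ (k : ℕ)) : v k = 0 := hv k hk
  ext k
  fin_cases k <;> simp [br, h]

theorem br_br_left (u v w : Pt) : br (br u v) w = 0 :=
  br_eq_zero_of_mem_Nm2 (br_mem_Nm2 u v) w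

theorem single_mem_Nm1 (i : Fin 24) (hi : 8 ≤ (i : ℕ)) (c : ℝ) : Pi.single i c ∈ Nm1 := by
  intro k hk
  have : k ≠ i := by
    rintro rfl
    omega
  simp [this]

/-- The basis vectors `X_9, X_10, X_11, X_13` suffice on the left to produce every element of
`n_{-2}` as a sum of brackets. -/
theorem eq_sum_br_of_mem_Nm2 {v : Pt} (hv : v ∈ Nm2) :
    v = br (Pi.single 8 1) (Pi.single 19 (-v 0) + Pi.single 21 (-v 1) + Pi.single 14 (-v 2)
          + Pi.single 15 (-v 3) + Pi.single 23 (v 4))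
      + br (Pi.single 9 1) (Pi.single 15 (-v 5))
      + br (Pi.single 10 1) (Pi.single 23 (-v 6))
      + br (Pi.single 12 1) (Pi.single 23 (-v 7)) := by
  have h (k : Fin 24) (hk : 8 ≤ (k : ℕ)) : v k = 0 := hv k hk
  ext k
  fin_cases k <;> simp [br, h]

theorem span_br_Nm1 :
    Submodule.span ℝ {x : Pt | ∃ v ∈ Nm1, ∃ w ∈ Nm1, br v w = x} = Nm2 := by
  apply le_antisymm
  · rw [Submodule.span_le]
    rintro _ ⟨v, -, w, -, rfl⟩
    exact br_mem_Nm2 v w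
  · intro v hv
    rw [eq_sum_br_of_mem_Nm2 hv]
    have key {x y : Pt} (hx : x ∈ Nm1) (hy : y ∈ Nm1) :
        br x y ∈ Submodule.span ℝ {x : Pt | ∃ v ∈ Nm1, ∃ w ∈ Nm1, br v w = x} :=
      Submodule.subset_span ⟨x, hx, y, hy, rfl⟩
    refine add_mem (add_mem (add_mem (key ?_ (add_mem (add_mem (add_mem (add_mem ?_ ?_) ?_) ?_) ?_))
      (key ?_ ?_)) (key ?_ ?_)) (key ?_ ?_) <;> exact single_mem_Nm1 _ (by decide) _

theorem Nm1_inf_Nm2 : Nm1 ⊓ Nm2 = ⊥ := by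
  rw [eq_bot_iff]
  rintro v ⟨h1, h2⟩
  rw [Submodule.mem_bot]
  ext k
  rcases lt_or_ge (k : ℕ) 8 with hk | hk
  · exact h1 k hk
  · exact h2 k hk

theorem Nm1_sup_Nm2 : Nm1 ⊔ Nm2 = ⊤ := by
  rw [eq_top_iff]
  intro v _
  rw [Submodule.mem_sup]
  refine ⟨fun k => if (k : ℕ) < 8 then 0 else v k, fun k hk => by simp [hk],
    fun k => if (k : ℕ) < 8 then v k else 0, fun k hk => by simp [Nat.not_lt.mpr hk], ?_⟩
  ext k
  by_cases hk : (k : ℕ) < 8 <;> simp [hk]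

/-- The bracket defined by the E_II structure equations makes `n_{E_II} = n_{-2} ⊕ n_{-1}`
a 2-step nilpotent graded Lie algebra: `n_{-2}` is central, `[n_{-1}, n_{-1}] = n_{-2}`
(so the algebra is fundamental), and `[n, [n, n]] = 0`. -/
theorem nEII_is_two_step_nilpotent_graded_Lie_algebra :
    -- the bracket is bilinear …
    (∀ (a : ℝ) (v v' w : Pt), br (a • v + v') w = a • br v w + br v' w) ∧
    (∀ (a : ℝ) (v w w' : Pt), br v (a • w + w') = a • br v w + br v w') ∧
    -- … antisymmetric …
    (∀ v w : Pt, br v w = -br w v) ∧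
    -- … and satisfies the Jacobi identity, …
    (∀ v w x : Pt, br (br v w) x + br (br w x) v + br (br x v) w = 0) ∧
    -- … the algebra is the direct sum of the two strata, …
    Nm1 ⊓ Nm2 = ⊥ ∧ Nm1 ⊔ Nm2 = ⊤ ∧
    -- … the stratum n_{-2} is central, …
    (∀ v ∈ Nm2, ∀ w : Pt, br v w = 0) ∧
    -- … [n_{-1}, n_{-1}] = n_{-2} (fundamentality), …
    Submodule.span ℝ {x : Pt | ∃ v ∈ Nm1, ∃ w ∈ Nm1, br v w = x} = Nm2 ∧
    -- … and the algebra is 2-step nilpotent.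
    (∀ u v w : Pt, br u (br v w) = 0) := by
  refine ⟨br_add_smul_left, br_add_smul_right, br_antisymm, fun v w x => ?_, Nm1_inf_Nm2,
    Nm1_sup_Nm2, fun v hv w => br_eq_zero_of_mem_Nm2 hv w, span_br_Nm1, fun u v w => ?_⟩
  · simp only [br_br_left, add_zero]
  · rw [br_antisymm, br_br_left, neg_zero]
end
end
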